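/- arXiv:math/9808118 — 2 statements merged into one kernel-verified Lean document; each statement's English description precedes it below -/
import Mathlib

section
/- Let n ≥ 1, let c be a nonnegative integer or half-integer, and let p be a nonnegative integer with p ≤ c. Then, as an identity of rational functions (in y_1,…,y_n with x_j = y_j^2 if c is a half-integer), so_{2n+1}((c^{n−1}, c−p); x^{±1}) = (x_1 x_2 ⋯ x_n)^{−c} · Σ_{ν ⊆ ((2c)^n)} b_{n,p}(ν) · s_n(ν; x), where the sum ranges over all partitions ν with at most n parts, each part at most 2c, and b_{n,p}(ν) is the number of partitions ρ ⊆ ν such that ν/ρ is a horizontal strip with exactly p cells whose i-th cell from the left (i = 1,…,p) lies in a column of index strictly less than 2c−2p+2i. -/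
open scoped Classical
open Finset

noncomputable section

/-- Complete homogeneous symmetric polynomial of degree `m` in the variables `x`
(`0` for negative `m`). -/
def hpoly {R : Type} [CommRing R] {N : ℕ} (x : Fin N → R) (m : ℤ) : R :=
  if 0 ≤ m then
    ∑ f ∈ Finset.univ.filter (fun f : Fin m.toNat → Fin N => Monotone f), ∏ i, x (f i)
  else 0

/-- The Schur function `s(λ; x) = det(h_{λ_i-i+j})` (indices `1 ≤ i,j ≤ r`). -/
def schur {R : Type} [CommRing R] {N r : ℕ} (lam : Fin r → ℤ) (x : Fin N → R) : R :=
  Matrix.det (Matrix.of fun i j : Fin r =>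
    hpoly x (lam i - ((i : ℕ) : ℤ) + ((j : ℕ) : ℤ)))

/-- The field of rational functions in `n` variables over `ℚ`. -/
abbrev FF (n : ℕ) : Type := FractionRing (MvPolynomial (Fin n) ℚ)

/-- The variables, as elements of the rational function field. -/
def Xv (n : ℕ) : Fin n → FF n := fun i =>
  algebraMap (MvPolynomial (Fin n) ℚ) (FF n) (MvPolynomial.X i)

/-- Irreducible odd orthogonal character `so_{2n+1}(λ; x^{±1})`, written in the
variables `y` where `x_j = y_j²`; here `L` is the doubled index, `L = 2λ`. -/
def soOdd {F : Type} [Field F] (n : ℕ) (L : Fin n → ℤ) (y : Fin n → F) : F :=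
  Matrix.det (Matrix.of fun i j : Fin n =>
    y j ^ (L i + 2 * (n : ℤ) - 2 * ((i : ℕ) : ℤ) - 1) -
      y j ^ (-(L i + 2 * (n : ℤ) - 2 * ((i : ℕ) : ℤ) - 1))) /
  Matrix.det (Matrix.of fun i j : Fin n =>
    y j ^ (2 * (n : ℤ) - 2 * ((i : ℕ) : ℤ) - 1) -
      y j ^ (-(2 * (n : ℤ) - 2 * ((i : ℕ) : ℤ) - 1)))


/-- `b_{n,p}(ν)`: the number of partitions `ρ ⊆ ν` such that `ν/ρ` is a horizontal
strip with exactly `p` cells whose `i`-th cell from the left lies in a column of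
index strictly less than `2c - 2p + 2i` (here `C = 2c`). -/
def bCoeff (n C p : ℕ) (ν : Fin n → ℕ) : ℕ :=
  ((Fintype.piFinset fun _ : Fin n => Finset.range (C + 1)).filter
    (fun ρ => Antitone ρ ∧ (∀ i, ρ i ≤ ν i) ∧
      (∀ i j : Fin n, (i : ℕ) + 1 = (j : ℕ) → ν j ≤ ρ i) ∧
      (∑ i : Fin n, (ν i - ρ i)) = p ∧
      (∀ i : Fin n, ∀ j : ℕ, ρ i < j → j ≤ ν i →
        (j : ℤ) < (C : ℤ) - 2 * (p : ℤ) +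
          2 * ((∑ i' : Fin n,
            ((Finset.Ioc (ρ i') (ν i')).filter (fun j' => j' ≤ j)).card : ℤ))))).card


/-! ### Part A: a partial fraction identity -/

/-- Pair factor. -/
def qf {K : Type} [Field K] {N : ℕ} (x : Fin N → K) (S : Finset (Fin N)) (i j : Fin N) : K :=
  if i ∈ S then (if j ∈ S then x i * x j - 1 else x i - x j)
  else (if j ∈ S then x j - x i else 1 - x i * x j)

/-- Single factor. -/
def df {K : Type} [Field K] {N : ℕ} (x : Fin N → K) (S : Finset (Fin N)) (i : Fin N) : K :=
  if i ∈ S then x i - 1 else 1 - x i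

/-- Product over ordered pairs. -/
def pp {K : Type} [Field K] {N : ℕ} (A : Finset (Fin N)) (f : Fin N → Fin N → K) : K :=
  ∏ i ∈ A, ∏ j ∈ A, if i < j then f i j else 1

def Den {K : Type} [Field K] {N : ℕ} (x : Fin N → K) (A S : Finset (Fin N)) : K :=
  (∏ i ∈ A, df x S i) * pp A (qf x S)

def Psi {K : Type} [Field K] {N : ℕ} (x : Fin N → K) (A : Finset (Fin N)) (M : ℕ) : K :=
  ∑ S ∈ A.powerset, (∏ i ∈ S, x i) ^ M / Den x A S

structure Gen {K : Type} [Field K] {N : ℕ} (x : Fin N → K) : Prop where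
  inj : ∀ i j, i ≠ j → x i ≠ x j
  one : ∀ i, x i ≠ 1
  neg : ∀ i, x i ≠ -1
  mul : ∀ i j, i ≠ j → x i * x j ≠ 1

theorem pp_insert {K : Type} [Field K] {N : ℕ} {A : Finset (Fin N)} {a : Fin N} (ha : a ∉ A)
    {f : Fin N → Fin N → K} (hf : ∀ i j, f i j = f j i) :
    pp (insert a A) f = pp A f * ∏ i ∈ A, f a i := by
  unfold pp
  rw [Finset.prod_insert ha]
  simp only [Finset.prod_insert ha, lt_irrefl, if_false, one_mul]
  rw [Finset.prod_mul_distrib, ← mul_assoc, ← Finset.prod_mul_distrib, mul_comm]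
  congr 1
  apply Finset.prod_congr rfl
  intro i hi
  have hne : a ≠ i := fun h => ha (h ▸ hi)
  rcases lt_or_gt_of_ne hne with h | h
  · simp [h, not_lt_of_gt h]
  · simp [h, not_lt_of_gt h, hf i a]

theorem qf_symm {K : Type} [Field K] {N : ℕ} (x : Fin N → K) (S : Finset (Fin N)) (i j : Fin N) :
    qf x S i j = qf x S j i := by
  unfold qf
  split_ifs <;> ring

theorem qf_ne {K : Type} [Field K] {N : ℕ} {x : Fin N → K} (hx : Gen x) (S : Finset (Fin N))
    {i j : Fin N} (h : i ≠ j) : qf x S i j ≠ 0 := by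
  unfold qf
  split_ifs
  · exact sub_ne_zero.2 (hx.mul i j h)
  · exact sub_ne_zero.2 (hx.inj i j h)
  · exact sub_ne_zero.2 (hx.inj j i h.symm)
  · exact sub_ne_zero.2 (hx.mul i j h).symm

theorem df_ne {K : Type} [Field K] {N : ℕ} {x : Fin N → K} (hx : Gen x) (S : Finset (Fin N))
    (i : Fin N) : df x S i ≠ 0 := by
  unfold df
  split_ifs
  · exact sub_ne_zero.2 (hx.one i)
  · exact sub_ne_zero.2 (hx.one i).symm

theorem Den_ne {K : Type} [Field K] {N : ℕ} {x : Fin N → K} (hx : Gen x) (A S : Finset (Fin N)) :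
    Den x A S ≠ 0 := by
  unfold Den pp
  refine mul_ne_zero (Finset.prod_ne_zero_iff.2 fun i _ => df_ne hx S i) ?_
  refine Finset.prod_ne_zero_iff.2 fun i _ => Finset.prod_ne_zero_iff.2 fun j _ => ?_
  split_ifs with h
  · exact qf_ne hx S h.ne
  · exact one_ne_zero

/-- Removing an element of `S`. -/
theorem Den_erase {K : Type} [Field K] {N : ℕ} {x : Fin N → K} {A S : Finset (Fin N)}
    (hS : S ⊆ A) {j : Fin N} (hj : j ∈ S) :
    Den x A S = Den x (A.erase j) (S.erase j) *
      ((x j - 1) * (∏ i ∈ S.erase j, (x i * x j - 1)) * ∏ i ∈ A \ S, (x j - x i)) := by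
  have hA : A = insert j (A.erase j) := (Finset.insert_erase (hS hj)).symm
  have hn : j ∉ A.erase j := Finset.notMem_erase j A
  have h1 : Den x A S = (df x S j * ∏ i ∈ A.erase j, df x S i) *
      (pp (A.erase j) (qf x S) * ∏ i ∈ A.erase j, qf x S j i) := by
    conv_lhs => rw [hA]
    unfold Den
    rw [Finset.prod_insert hn, pp_insert hn (qf_symm x S)]
  have h2 : ∏ i ∈ A.erase j, df x S i = ∏ i ∈ A.erase j, df x (S.erase j) i := by
    apply Finset.prod_congr rfl
    intro i hi
    simp [df, Finset.ne_of_mem_erase hi]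
  have h3 : pp (A.erase j) (qf x S) = pp (A.erase j) (qf x (S.erase j)) := by
    unfold pp
    apply Finset.prod_congr rfl
    intro i hi
    apply Finset.prod_congr rfl
    intro k hk
    simp [qf, Finset.ne_of_mem_erase hi, Finset.ne_of_mem_erase hk]
  have h4 : A.erase j = S.erase j ∪ A \ S := by
    ext i
    simp only [Finset.mem_erase, Finset.mem_union, Finset.mem_sdiff]
    constructor
    · rintro ⟨h, h'⟩
      by_cases hi : i ∈ S
      · exact Or.inl ⟨h, hi⟩
      · exact Or.inr ⟨h', hi⟩
    · rintro (⟨h, h'⟩ | ⟨h, h'⟩)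
      · exact ⟨h, hS h'⟩
      · exact ⟨fun e => h' (e ▸ hj), h⟩
  have h5 : Disjoint (S.erase j) (A \ S) := by
    rw [Finset.disjoint_left]
    intro i hi hi'
    exact (Finset.mem_sdiff.1 hi').2 (Finset.mem_of_mem_erase hi)
  have h6 : ∏ i ∈ A.erase j, qf x S j i =
      (∏ i ∈ S.erase j, (x i * x j - 1)) * ∏ i ∈ A \ S, (x j - x i) := by
    rw [h4, Finset.prod_union h5]
    congr 1
    · apply Finset.prod_congr rfl
      intro i hi
      simp [qf, hj, Finset.mem_of_mem_erase hi, mul_comm]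
    · apply Finset.prod_congr rfl
      intro i hi
      simp [qf, hj, (Finset.mem_sdiff.1 hi).2]
  rw [h1, h2, h3, h6]
  have : df x S j = x j - 1 := by simp [df, hj]
  rw [this]
  unfold Den
  ring

/-- Residue identity. -/
theorem residue_id {K : Type} [Field K] {N : ℕ} {x : Fin N → K} (hx : Gen x)
    (S : Finset (Fin N)) :
    ∑ j ∈ S, ((x j - 1) * ∏ i ∈ S.erase j, (x i * x j - 1)) / ∏ i ∈ S.erase j, (x j - x i)
      = (∏ i ∈ S, x i) - 1 := by
  let v : Option (Fin N) → K := fun o => o.elim (-1) x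
  have hv : Set.InjOn v (Finset.insertNone S : Finset (Option (Fin N))) := by
    rintro (_ | a) _ (_ | b) _ h
    · rfl
    · exact absurd h.symm (hx.neg b)
    · exact absurd h (hx.neg a)
    · by_contra hne
      exact hx.inj a b (fun e => hne (by rw [e])) h
  let P : Polynomial K := ∏ i ∈ S, (Polynomial.C (x i) * Polynomial.X + Polynomial.C (-1))
  have hdeg : P.natDegree ≤ S.card := by
    refine (Polynomial.natDegree_prod_le _ _).trans ?_
    refine (Finset.sum_le_card_nsmul _ _ 1 fun i _ => ?_).trans (by simp)
    exact Polynomial.natDegree_linear_le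
  have hP : P.degree < (Finset.insertNone S).card := by
    rw [Finset.card_insertNone]
    refine lt_of_le_of_lt Polynomial.degree_le_natDegree ?_
    exact_mod_cast Nat.lt_succ_of_le hdeg
  have key := Lagrange.coeff_eq_sum hv hP
  have hc : P.coeff S.card = ∏ i ∈ S, x i := by
    have := Polynomial.coeff_prod_of_natDegree_le
      (fun i => Polynomial.C (x i) * Polynomial.X + Polynomial.C (-1)) 1 (s := S)
      (fun i _ => Polynomial.natDegree_linear_le)
    rw [mul_one] at this
    rw [this]
    apply Finset.prod_congr rfl
    intro i _
    rw [Polynomial.coeff_add, Polynomial.coeff_C_mul, Polynomial.coeff_X_one, Polynomial.coeff_C]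
    norm_num
  have hev : ∀ z : K, P.eval z = ∏ i ∈ S, (x i * z - 1) := by
    intro z
    simp only [P, Polynomial.eval_prod]
    apply Finset.prod_congr rfl
    intro i _
    simp [sub_eq_add_neg]
  rw [Finset.card_insertNone, Nat.add_sub_cancel, hc, Finset.sum_insertNone] at key
  have e0 : (Finset.insertNone S).erase none = S.map Function.Embedding.some := by
    ext o; cases o <;> simp
  have e1 : ∀ j : Fin N, (Finset.insertNone S).erase (some j) = Finset.insertNone (S.erase j) := by
    intro j; ext o; cases o <;> simp
  have n0 : P.eval (v none) / ∏ j ∈ (Finset.insertNone S).erase none, (v none - v j) = 1 := by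
    rw [hev, e0, Finset.prod_map, div_eq_one_iff_eq]
    · apply Finset.prod_congr rfl
      intro i _
      simp [v]; ring
    · refine Finset.prod_ne_zero_iff.2 fun i _ => ?_
      exact sub_ne_zero.2 (hx.neg i).symm
  rw [n0] at key
  rw [key, add_sub_cancel_left]
  apply Finset.sum_congr rfl
  intro j hj
  rw [hev, e1, Finset.prod_insertNone, ← Finset.mul_prod_erase _ _ hj]
  have hne : x j + 1 ≠ 0 := fun h => hx.neg j (eq_neg_of_add_eq_zero_left h)
  have hne2 : ∏ i ∈ S.erase j, (x j - x i) ≠ 0 :=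
    Finset.prod_ne_zero_iff.2 fun i hi => sub_ne_zero.2 (hx.inj j i (Finset.ne_of_mem_erase hi).symm)
  simp only [v, Option.elim]
  rw [div_eq_div_iff hne2 (mul_ne_zero (by simpa using hne) hne2)]
  ring

theorem Psi_rec {K : Type} [Field K] {N : ℕ} {x : Fin N → K} (hx : Gen x)
    (A : Finset (Fin N)) (M : ℕ) :
    Psi x A (M + 1) - Psi x A M =
      ∑ j ∈ A, x j ^ M / (∏ i ∈ A.erase j, (x j - x i)) * Psi x (A.erase j) M := by
  have hR : ∀ j ∈ A, x j ^ M / (∏ i ∈ A.erase j, (x j - x i)) * Psi x (A.erase j) M =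
      ∑ S ∈ A.powerset with j ∈ S, x j ^ M / (∏ i ∈ A.erase j, (x j - x i)) *
        ((∏ i ∈ S.erase j, x i) ^ M / Den x (A.erase j) (S.erase j)) := by
    intro j hj
    rw [Psi, Finset.mul_sum]
    symm
    refine Finset.sum_bij' (fun S _ => S.erase j) (fun S _ => insert j S) ?_ ?_ ?_ ?_ ?_
    · intro S hS
      simp only [Finset.mem_filter, Finset.mem_powerset] at hS ⊢
      exact Finset.erase_subset_erase _ hS.1
    · intro S hS
      simp only [Finset.mem_filter, Finset.mem_powerset] at hS ⊢
      refine ⟨?_, Finset.mem_insert_self _ _⟩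
      exact Finset.insert_subset hj (hS.trans (Finset.erase_subset _ _))
    · intro S hS
      simp only [Finset.mem_filter, Finset.mem_powerset] at hS
      exact Finset.insert_erase hS.2
    · intro S hS
      simp only [Finset.mem_powerset] at hS
      exact Finset.erase_insert (fun h => Finset.notMem_erase j A (hS h))
    · intro S hS
      rfl
  rw [Finset.sum_congr rfl hR]
  rw [Finset.sum_comm' (t' := A.powerset) (s' := fun S => S)]
  swap
  · intro j S
    simp only [Finset.mem_filter, Finset.mem_powerset]
    constructor
    · rintro ⟨h1, h2, h3⟩; exact ⟨h3, h2⟩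
    · rintro ⟨h1, h2⟩; exact ⟨h2 h1, h2, h1⟩
  rw [Psi, Psi, ← Finset.sum_sub_distrib]
  apply Finset.sum_congr rfl
  intro S hS
  rw [Finset.mem_powerset] at hS
  have : (∏ i ∈ S, x i) ^ (M + 1) / Den x A S - (∏ i ∈ S, x i) ^ M / Den x A S
      = (∏ i ∈ S, x i) ^ M / Den x A S * ((∏ i ∈ S, x i) - 1) := by ring
  rw [this, ← residue_id hx S, Finset.mul_sum]
  apply Finset.sum_congr rfl
  intro j hj
  have hd := Den_erase (x := x) hS hj
  have hd0 := Den_ne hx A S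
  have hp : ∏ i ∈ A.erase j, (x j - x i) =
      (∏ i ∈ S.erase j, (x j - x i)) * ∏ i ∈ A \ S, (x j - x i) := by
    have h4 : A.erase j = S.erase j ∪ A \ S := by
      ext i
      simp only [Finset.mem_erase, Finset.mem_union, Finset.mem_sdiff]
      constructor
      · rintro ⟨h, h'⟩
        by_cases hi : i ∈ S
        · exact Or.inl ⟨h, hi⟩
        · exact Or.inr ⟨h', hi⟩
      · rintro (⟨h, h'⟩ | ⟨h, h'⟩)
        · exact ⟨h, hS h'⟩
        · exact ⟨fun e => h' (e ▸ hj), h⟩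
    have h5 : Disjoint (S.erase j) (A \ S) := by
      rw [Finset.disjoint_left]
      intro i hi hi'
      exact (Finset.mem_sdiff.1 hi').2 (Finset.mem_of_mem_erase hi)
    rw [h4, Finset.prod_union h5]
  have hp1 : ∏ i ∈ S.erase j, (x j - x i) ≠ 0 :=
    Finset.prod_ne_zero_iff.2 fun i hi => sub_ne_zero.2 (hx.inj j i (Finset.ne_of_mem_erase hi).symm)
  rw [hp, ← Finset.mul_prod_erase _ _ hj, mul_pow, hd]
  rw [hd] at hd0
  have k1 := left_ne_zero_of_mul hd0
  have k2 := right_ne_zero_of_mul hd0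
  have k3 := right_ne_zero_of_mul k2
  have k4 := right_ne_zero_of_mul (left_ne_zero_of_mul k2)
  have k5 := left_ne_zero_of_mul (left_ne_zero_of_mul k2)
  generalize ∏ i ∈ S.erase j, (x i * x j - 1) = Y at *
  generalize ∏ i ∈ S.erase j, (x j - x i) = Z at *
  generalize ∏ i ∈ A \ S, (x j - x i) = W at *
  field_simp

/-! ### Part B: alternants, sums over strict chains, bounded Macdonald identity -/

/-- strictly decreasing sequences with entries `< M`. -/
def SC (n M : ℕ) : Finset (Fin n → ℕ) :=
  (Fintype.piFinset fun _ : Fin n => Finset.range M).filter StrictAnti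

theorem mem_SC {n M : ℕ} {μ : Fin n → ℕ} : μ ∈ SC n M ↔ (∀ i, μ i < M) ∧ StrictAnti μ := by
  simp [SC, Fintype.mem_piFinset]

def alt {K : Type} [Field K] {n : ℕ} (x : Fin n → K) (μ : Fin n → ℕ) : K :=
  Matrix.det (Matrix.of fun i j : Fin n => x j ^ μ i)

def fs {K : Type} [Field K] {n : ℕ} (x : Fin n → K) (M : ℕ) : K := ∑ μ ∈ SC n M, alt x μ

def Vd {K : Type} [Field K] {n : ℕ} (x : Fin n → K) : K := pp Finset.univ (fun i j => x i - x j)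

def Vp {K : Type} [Field K] {n : ℕ} (x : Fin n → K) : K := pp Finset.univ (fun i j => x j - x i)

def EE {K : Type} [Field K] {n : ℕ} (x : Fin n → K) : K :=
  (∏ i, (1 - x i)) * pp Finset.univ (fun i j => 1 - x i * x j)

def Dd {K : Type} [Field K] {n : ℕ} (x w : Fin n → K) : K :=
  Matrix.det (Matrix.of fun i j : Fin n => x i ^ (j : ℕ) - w i * x i ^ (j.rev : ℕ))

theorem strictAnti_cons {n M : ℕ} {μ : Fin n → ℕ} :
    StrictAnti (Fin.cons M μ : Fin (n + 1) → ℕ) ↔ (∀ i, μ i < M) ∧ StrictAnti μ := by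
  constructor
  · intro h
    refine ⟨fun i => ?_, fun i j hij => ?_⟩
    · have := h (Fin.succ_pos i)
      simpa using this
    · have := h (Fin.succ_lt_succ_iff.2 hij)
      simpa using this
  · rintro ⟨h1, h2⟩ i j hij
    induction j using Fin.cases with
    | zero => exact absurd hij (Fin.not_lt_zero i)
    | succ j =>
      induction i using Fin.cases with
      | zero => simpa using h1 j
      | succ i => simpa using h2 (Fin.succ_lt_succ_iff.1 hij)

theorem sum_SC_succ {K : Type} [Field K] {n M : ℕ} (F : (Fin (n + 1) → ℕ) → K) :
    ∑ μ ∈ SC (n + 1) (M + 1), F μ =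
      ∑ μ ∈ SC (n + 1) M, F μ + ∑ μ ∈ SC n M, F (Fin.cons M μ) := by
  rw [← Finset.sum_filter_add_sum_filter_not (SC (n + 1) (M + 1)) (fun μ => μ 0 < M)]
  congr 1
  · apply Finset.sum_congr _ (fun _ _ => rfl)
    ext μ
    simp only [Finset.mem_filter, mem_SC]
    constructor
    · rintro ⟨⟨h1, h2⟩, h3⟩
      exact ⟨fun i => lt_of_le_of_lt (h2.antitone (Fin.zero_le i)) h3, h2⟩
    · rintro ⟨h1, h2⟩
      exact ⟨⟨fun i => (h1 i).trans (Nat.lt_succ_self M), h2⟩, h1 0⟩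
  · refine Finset.sum_bij' (fun μ _ => Fin.tail μ) (fun μ _ => Fin.cons M μ) ?_ ?_ ?_ ?_ ?_
    · intro μ hμ
      simp only [Finset.mem_filter, mem_SC] at hμ ⊢
      obtain ⟨⟨h1, h2⟩, h3⟩ := hμ
      have h4 : μ 0 = M := by have := h1 0; omega
      rw [← Fin.cons_self_tail μ, h4] at h2
      exact strictAnti_cons.1 h2
    · intro μ hμ
      simp only [Finset.mem_filter, mem_SC] at hμ ⊢
      refine ⟨⟨fun i => ?_, strictAnti_cons.2 hμ⟩, by simp⟩
      induction i using Fin.cases with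
      | zero => simp
      | succ i => simpa using (hμ.1 i).trans (Nat.lt_succ_self M)
    · intro μ hμ
      simp only [Finset.mem_filter, mem_SC] at hμ
      have h4 : μ 0 = M := by have := hμ.1.1 0; omega
      rw [← h4]
      exact Fin.cons_self_tail μ
    · intro μ hμ
      exact Fin.tail_cons _ _
    · intro μ hμ
      simp only [Finset.mem_filter, mem_SC] at hμ
      have h4 : μ 0 = M := by have := hμ.1.1 0; omega
      rw [← h4]
      rw [Fin.cons_self_tail μ]

theorem alt_cons {K : Type} [Field K] {n : ℕ} (x : Fin (n + 1) → K) (m : ℕ) (μ : Fin n → ℕ) :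
    alt x (Fin.cons m μ) = ∑ j : Fin (n + 1), (-1) ^ (j : ℕ) * x j ^ m * alt (x ∘ j.succAbove) μ := by
  unfold alt
  rw [Matrix.det_succ_row_zero]
  apply Finset.sum_congr rfl
  intro j _
  congr 1

theorem fs_rec {K : Type} [Field K] {n : ℕ} (x : Fin (n + 1) → K) (M : ℕ) :
    fs x (M + 1) = fs x M +
      ∑ j : Fin (n + 1), (-1) ^ (j : ℕ) * x j ^ M * fs (x ∘ j.succAbove) M := by
  unfold fs
  rw [sum_SC_succ]
  congr 1
  simp only [alt_cons, Finset.mul_sum]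
  rw [Finset.sum_comm]

theorem prod_sign {K : Type} [Field K] {n : ℕ} (j : Fin (n + 1)) :
    ∏ i : Fin n, (if j.succAbove i < j then (-1 : K) else 1) = (-1) ^ (j : ℕ) := by
  have h := Fin.prod_univ_succAbove (fun i : Fin (n + 1) => if i < j then (-1 : K) else 1) j
  simp only [lt_irrefl, if_false, one_mul] at h
  rw [← h, ← Finset.prod_filter, Finset.prod_const]
  congr 1
  have : Finset.univ.filter (fun i : Fin (n + 1) => i < j) = Finset.Iio j := by ext; simp
  rw [this, Fin.card_Iio]

theorem Vd_succAbove {K : Type} [Field K] {n : ℕ} (x : Fin (n + 1) → K) (j : Fin (n + 1)) :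
    Vd x = (-1) ^ (j : ℕ) * (∏ i : Fin n, (x j - x (j.succAbove i))) * Vd (x ∘ j.succAbove) := by
  unfold Vd pp
  rw [Fin.prod_univ_succAbove _ j]
  simp only [Fin.prod_univ_succAbove _ j, lt_irrefl, if_false, one_mul,
    (Fin.strictMono_succAbove j).lt_iff_lt, Function.comp]
  rw [← prod_sign]
  simp only [← Finset.prod_mul_distrib]
  apply Finset.prod_congr rfl
  intro i _
  rcases lt_or_gt_of_ne (Fin.succAbove_ne j i) with h | h
  · simp [h, not_lt_of_gt h]
  · simp [h, not_lt_of_gt h]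

theorem pp_univ {K : Type} [Field K] {n : ℕ} (f : Fin n → Fin n → K) :
    pp Finset.univ f = ∏ i, ∏ j ∈ Finset.Ioi i, f i j := by
  unfold pp
  apply Finset.prod_congr rfl
  intro i _
  rw [← Finset.prod_filter]
  apply Finset.prod_congr _ (fun _ _ => rfl)
  ext; simp

theorem pp_mul {K : Type} [Field K] {n : ℕ} (A : Finset (Fin n)) (f g : Fin n → Fin n → K) :
    pp A f * pp A g = pp A (fun i j => f i j * g i j) := by
  unfold pp
  rw [← Finset.prod_mul_distrib]
  apply Finset.prod_congr rfl
  intro i _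
  rw [← Finset.prod_mul_distrib]
  apply Finset.prod_congr rfl
  intro j _
  split_ifs <;> simp

theorem Dd_eq {K : Type} [Field K] {n : ℕ} {x : Fin n → K} (hx : Gen x) (M : ℕ) :
    Dd x (fun i => x i ^ M) = EE x * Vp x * Psi x Finset.univ M := by
  have h1 : Dd x (fun i => x i ^ M) = ∑ S : Finset (Fin n), (∏ i ∈ S, (-x i ^ M)) *
      (Matrix.projVandermonde (fun i => if i ∈ S then 1 else x i)
        (fun i => if i ∈ S then x i else 1)).det := by
    have := (Matrix.detRowAlternating (n := Fin n) (R := K)).toMultilinearMap.map_add_univ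
      (fun i => (-x i ^ M) • (fun j : Fin n => x i ^ (j.rev : ℕ)))
      (fun i => (fun j : Fin n => x i ^ (j : ℕ)))
    have h2 : Dd x (fun i => x i ^ M) = (Matrix.detRowAlternating (n := Fin n) (R := K)).toMultilinearMap
        ((fun i => (-x i ^ M) • (fun j : Fin n => x i ^ (j.rev : ℕ))) +
      (fun i => (fun j : Fin n => x i ^ (j : ℕ)))) := by
      unfold Dd
      change _ = Matrix.det _
      congr 1
      ext i j
      simp
      ring
    rw [h2, this]
    apply Finset.sum_congr rfl
    intro S _
    change Matrix.det _ = _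
    have h3 := Matrix.det_mul_column (fun i => if i ∈ S then (-x i ^ M) else 1)
      (Matrix.projVandermonde (fun i => if i ∈ S then 1 else x i)
        (fun i => if i ∈ S then x i else 1))
    rw [Finset.prod_ite_mem, Finset.univ_inter] at h3
    rw [← h3]
    congr 1
    ext i j
    by_cases hi : i ∈ S
    · simp [hi, Matrix.projVandermonde_apply]
    · simp [hi, Matrix.projVandermonde_apply]
  rw [h1, Psi, Finset.mul_sum, Finset.powerset_univ]
  apply Finset.sum_congr rfl
  intro S _
  have h4 : (Matrix.projVandermonde (fun i => if i ∈ S then 1 else x i)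
        (fun i => if i ∈ S then x i else 1)).det * (-1) ^ S.card * Den x Finset.univ S
        = EE x * Vp x := by
    rw [Matrix.det_projVandermonde, ← pp_univ
      (fun i j => (if j ∈ S then 1 else x j) * (if i ∈ S then x i else 1) -
        (if i ∈ S then 1 else x i) * (if j ∈ S then x j else 1))]
    have h5 : (-1 : K) ^ S.card = ∏ i, if i ∈ S then (-1 : K) else 1 := by
      rw [Finset.prod_ite_mem, Finset.univ_inter, Finset.prod_const]
    rw [h5]
    unfold Den EE Vp
    have h6 : (∏ i, if i ∈ S then (-1 : K) else 1) * ∏ i, df x S i = ∏ i, (1 - x i) := by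
      rw [← Finset.prod_mul_distrib]
      apply Finset.prod_congr rfl
      intro i _
      unfold df
      split_ifs <;> ring
    rw [← h6]
    have h7 : pp Finset.univ (fun i j => (if j ∈ S then 1 else x j) * (if i ∈ S then x i else 1) -
        (if i ∈ S then 1 else x i) * (if j ∈ S then x j else 1)) * pp Finset.univ (qf x S) =
        pp Finset.univ (fun i j => 1 - x i * x j) * pp Finset.univ (fun i j => x j - x i) := by
      rw [pp_mul, pp_mul]
      congr 1
      funext i j
      unfold qf
      split_ifs <;> ring
    linear_combination ((∏ i, if i ∈ S then (-1 : K) else 1) * ∏ i, df x S i) * h7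
  rw [← h4, Finset.prod_neg, Finset.prod_pow]
  have h8 := Den_ne hx Finset.univ S
  field_simp

theorem pp_ne {K : Type} [Field K] {n : ℕ} {A : Finset (Fin n)} {f : Fin n → Fin n → K}
    (h : ∀ i j, i ≠ j → f i j ≠ 0) : pp A f ≠ 0 := by
  refine Finset.prod_ne_zero_iff.2 fun i _ => Finset.prod_ne_zero_iff.2 fun j _ => ?_
  split_ifs with hh
  · exact h _ _ hh.ne
  · exact one_ne_zero

theorem EE_ne {K : Type} [Field K] {n : ℕ} {x : Fin n → K} (hx : Gen x) : EE x ≠ 0 :=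
  mul_ne_zero (Finset.prod_ne_zero_iff.2 fun i _ => sub_ne_zero.2 (hx.one i).symm)
    (pp_ne fun i j h => sub_ne_zero.2 (hx.mul i j h).symm)

theorem Vp_ne {K : Type} [Field K] {n : ℕ} {x : Fin n → K} (hx : Gen x) : Vp x ≠ 0 :=
  pp_ne fun i j h => sub_ne_zero.2 (hx.inj j i h.symm)

theorem Vd_ne {K : Type} [Field K] {n : ℕ} {x : Fin n → K} (hx : Gen x) : Vd x ≠ 0 :=
  pp_ne fun i j h => sub_ne_zero.2 (hx.inj i j h)

theorem Dd_one {K : Type} [Field K] {n : ℕ} (x : Fin (n + 1) → K) :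
    Dd x (fun i => x i ^ 0) = 0 := by
  unfold Dd
  rcases Nat.eq_zero_or_pos n with rfl | hn
  · apply Matrix.det_eq_zero_of_column_eq_zero 0
    intro i
    simp
  · have hne : (0 : Fin (n + 1)) ≠ Fin.last n := by
      intro h
      have := congrArg Fin.val h
      simp at this
      omega
    rw [← Matrix.det_updateCol_add_self _ hne]
    apply Matrix.det_eq_zero_of_column_eq_zero 0
    intro i
    simp

theorem Psi_zero {K : Type} [Field K] {n : ℕ} {x : Fin (n + 1) → K} (hx : Gen x) :
    Psi x Finset.univ 0 = 0 := by
  have h := Dd_eq hx 0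
  rw [Dd_one] at h
  have := mul_ne_zero (EE_ne hx) (Vp_ne hx)
  rcases mul_eq_zero.1 h.symm with h | h
  · exact absurd h this
  · exact h

theorem Gen.comp {K : Type} [Field K] {n N : ℕ} {x : Fin N → K} (hx : Gen x) (e : Fin n ↪o Fin N) :
    Gen (x ∘ e) where
  inj i j h := hx.inj _ _ (e.injective.ne h)
  one i := hx.one _
  neg i := hx.neg _
  mul i j h := hx.mul _ _ (e.injective.ne h)

theorem Den_map {K : Type} [Field K] {n N : ℕ} (x : Fin N → K) (e : Fin n ↪o Fin N)
    (A S : Finset (Fin n)) :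
    Den x (A.map e.toEmbedding) (S.map e.toEmbedding) = Den (x ∘ e) A S := by
  unfold Den pp df qf
  simp only [Finset.prod_map]
  have : ∀ i, e.toEmbedding i ∈ S.map e.toEmbedding ↔ i ∈ S := fun i => Finset.mem_map' _
  simp only [this]
  simp

theorem Psi_map {K : Type} [Field K] {n N : ℕ} (x : Fin N → K) (e : Fin n ↪o Fin N)
    (A : Finset (Fin n)) (M : ℕ) :
    Psi x (A.map e.toEmbedding) M = Psi (x ∘ e) A M := by
  unfold Psi
  have : (A.map e.toEmbedding).powerset = A.powerset.map (Finset.mapEmbedding e.toEmbedding).toEmbedding := by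
    ext S
    simp only [Finset.mem_powerset, Finset.mem_map, Finset.subset_map_iff]
    constructor
    · rintro ⟨u, h1, h2⟩
      exact ⟨u, h1, h2.symm⟩
    · rintro ⟨u, h1, h2⟩
      exact ⟨u, h1, h2.symm⟩
  rw [this, Finset.sum_map]
  apply Finset.sum_congr rfl
  intro S _
  have h2 : (Finset.mapEmbedding e.toEmbedding).toEmbedding S = S.map e.toEmbedding := rfl
  rw [h2, Den_map, Finset.prod_map]
  rfl

theorem fs_eq {K : Type} [Field K] : ∀ {n : ℕ} {x : Fin n → K} (_ : Gen x) (M : ℕ),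
    fs x M = Vd x * Psi x Finset.univ M := by
  intro n
  induction n with
  | zero =>
    intro x hx M
    have h1 : SC 0 M = {Fin.elim0} := by
      ext μ
      simp only [mem_SC, Finset.mem_singleton]
      constructor
      · intro _
        exact Subsingleton.elim _ _
      · intro _
        exact ⟨fun i => i.elim0, fun i => i.elim0⟩
    simp [fs, h1, alt, Vd, pp, Psi, Den]
  | succ n ih =>
    intro x hx M
    induction M with
    | zero =>
      rw [Psi_zero hx, mul_zero]
      unfold fs
      apply Finset.sum_eq_zero
      intro μ hμ
      have := (mem_SC.1 hμ).1 0
      omega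
    | succ M ihM =>
      have hr := Psi_rec hx Finset.univ M
      rw [fs_rec, ihM, eq_add_of_sub_eq hr, mul_add, add_comm, Finset.mul_sum]
      congr 1
      apply Finset.sum_congr rfl
      intro j _
      have hg : Gen (x ∘ j.succAbove) := hx.comp (Fin.succAboveOrderEmb j)
      rw [ih hg M, Vd_succAbove x j]
      have hA : (Finset.univ.erase j) = Finset.univ.map (Fin.succAboveOrderEmb j).toEmbedding := by
        ext i
        simp only [Finset.mem_erase, Finset.mem_univ, and_true, Finset.mem_map, true_and]
        exact Fin.exists_succAbove_eq_iff.symm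
      rw [hA, Psi_map, Finset.prod_map]
      have hne : ∏ i : Fin n, (x j - x (j.succAbove i)) ≠ 0 :=
        Finset.prod_ne_zero_iff.2 fun i _ => sub_ne_zero.2 (hx.inj _ _ (Fin.succAbove_ne j i).symm)
      change _ = (-1) ^ (j : ℕ) * (∏ i : Fin n, (x j - x (j.succAbove i))) * Vd (x ∘ j.succAbove) *
        (x j ^ M / (∏ i : Fin n, (x j - x (j.succAbove i))) * Psi (x ∘ j.succAbove) Finset.univ M)
      generalize ∏ i : Fin n, (x j - x (j.succAbove i)) = Z at *
      field_simp

/-! ### Part C: branching -/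

theorem det_last_col {K : Type} [Field K] {n : ℕ} (B : Matrix (Fin (n + 1)) (Fin (n + 1)) K)
    (h : ∀ i : Fin n, B i.castSucc (Fin.last n) = 0) :
    B.det = B (Fin.last n) (Fin.last n) * (B.submatrix Fin.castSucc Fin.castSucc).det := by
  rw [Matrix.det_succ_column B (Fin.last n), Fin.sum_univ_castSucc]
  simp only [h, mul_zero, zero_mul, Finset.sum_const_zero, zero_add]
  have : (Fin.last n).succAbove = Fin.castSucc := Fin.succAbove_last
  rw [this]
  simp [← two_mul]

def lowf {n : ℕ} (μ : Fin n → ℕ) : Fin (n + 1) → ℕ :=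
  Fin.snoc (α := fun _ => ℕ) (fun i => μ i + 1) 0

def upf {n : ℕ} (M : ℕ) (μ : Fin n → ℕ) : Fin (n + 1) → ℕ := Fin.cons (α := fun _ => ℕ) M μ

def extv {K : Type} [Field K] {n : ℕ} (x : Fin n → K) (t : K) : Fin (n + 1) → K :=
  Fin.snoc (α := fun _ => K) x t

@[simp] theorem extv_castSucc {K : Type} [Field K] {n : ℕ} (x : Fin n → K) (t : K) (i : Fin n) :
    extv x t i.castSucc = x i := by simp [extv]

@[simp] theorem extv_last {K : Type} [Field K] {n : ℕ} (x : Fin n → K) (t : K) :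
    extv x t (Fin.last n) = t := by simp [extv]

@[simp] theorem lowf_castSucc {n : ℕ} (μ : Fin n → ℕ) (i : Fin n) :
    lowf μ i.castSucc = μ i + 1 := by simp [lowf]

@[simp] theorem lowf_last {n : ℕ} (μ : Fin n → ℕ) : lowf μ (Fin.last n) = 0 := by simp [lowf]

@[simp] theorem upf_zero {n M : ℕ} (μ : Fin n → ℕ) : upf M μ 0 = M := by simp [upf]

@[simp] theorem upf_succ {n M : ℕ} (μ : Fin n → ℕ) (i : Fin n) : upf M μ i.succ = μ i := by
  simp [upf]

theorem alt_ext {K : Type} [Field K] {n : ℕ} (x : Fin n → K) (t : K) (κ : Fin (n + 1) → ℕ)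
    (hκ : StrictAnti κ) :
    alt (extv x t) κ = (∏ j, (x j - t)) *
      ∑ μ ∈ Fintype.piFinset (fun i : Fin n => Finset.Ico (κ i.succ) (κ i.castSucc)),
        (∏ i, t ^ (κ i - lowf μ i)) * alt x μ := by
  have hle : ∀ i : Fin n, κ i.succ ≤ κ i.castSucc := fun i => (hκ Fin.castSucc_lt_succ).le
  let A : Matrix (Fin (n + 1)) (Fin (n + 1)) K := Matrix.of fun i j => extv x t j ^ κ i
  let B : Matrix (Fin (n + 1)) (Fin (n + 1)) K := Matrix.of fun i j =>
    Fin.lastCases (motive := fun _ => K) (extv x t j ^ κ (Fin.last n))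
      (fun i => extv x t j ^ κ i.castSucc -
        t ^ (κ i.castSucc - κ i.succ) * extv x t j ^ κ i.succ) i
  have hBl : ∀ j, B (Fin.last n) j = extv x t j ^ κ (Fin.last n) := by intro j; simp [B]
  have hBc : ∀ (i : Fin n) j, B i.castSucc j = extv x t j ^ κ i.castSucc -
        t ^ (κ i.castSucc - κ i.succ) * extv x t j ^ κ i.succ := by intro i j; simp [B]
  have hAB : A.det = B.det := by
    rw [← Matrix.det_submatrix_equiv_self Fin.revPerm A,
      ← Matrix.det_submatrix_equiv_self Fin.revPerm B]
    apply Matrix.det_eq_of_forall_row_eq_smul_add_pred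
      (fun i : Fin n => t ^ (κ i.rev.castSucc - κ i.rev.succ))
    · intro j
      simp only [Matrix.submatrix_apply, Fin.revPerm_apply, Fin.rev_zero, hBl]
      rfl
    · intro i j
      simp only [Matrix.submatrix_apply, Fin.revPerm_apply, Fin.rev_succ, Fin.rev_castSucc, hBc]
      simp [A]
  have h0 : ∀ i : Fin n, B i.castSucc (Fin.last n) = 0 := by
    intro i
    rw [hBc, extv_last, ← pow_add, Nat.sub_add_cancel (hle i), sub_self]
  change A.det = _
  rw [hAB, det_last_col B h0, hBl, extv_last]
  have h1 : B.submatrix Fin.castSucc Fin.castSucc = Matrix.of fun i j : Fin n => (x j - t) *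
      (Matrix.of fun i j : Fin n =>
        ∑ m ∈ Finset.Ico (κ i.succ) (κ i.castSucc), t ^ (κ i.castSucc - (m + 1)) * x j ^ m) i j := by
    ext i j
    rw [Matrix.submatrix_apply, hBc, extv_castSucc, Matrix.of_apply, Matrix.of_apply]
    have := mul_geom_sum₂_Ico (x j) t (hle i)
    rw [mul_comm (t ^ _), ← this]
    congr 1
    apply Finset.sum_congr rfl
    intro m _
    rw [mul_comm, Nat.sub_sub, add_comm 1 m]
  rw [h1, Matrix.det_mul_row]
  have h2 : Matrix.det (Matrix.of fun i j : Fin n =>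
        ∑ m ∈ Finset.Ico (κ i.succ) (κ i.castSucc), t ^ (κ i.castSucc - (m + 1)) * x j ^ m) =
      ∑ μ ∈ Fintype.piFinset (fun i : Fin n => Finset.Ico (κ i.succ) (κ i.castSucc)),
        (∏ i : Fin n, t ^ (κ i.castSucc - (μ i + 1))) * alt x μ := by
    have := (Matrix.detRowAlternating (n := Fin n) (R := K)).toMultilinearMap.map_sum_finset
      (fun (i : Fin n) (m : ℕ) => (fun j : Fin n => t ^ (κ i.castSucc - (m + 1)) * x j ^ m))
      (fun i : Fin n => Finset.Ico (κ i.succ) (κ i.castSucc))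
    have e : Matrix.det (Matrix.of fun i j : Fin n =>
        ∑ m ∈ Finset.Ico (κ i.succ) (κ i.castSucc), t ^ (κ i.castSucc - (m + 1)) * x j ^ m) =
        (Matrix.detRowAlternating (n := Fin n) (R := K)).toMultilinearMap (fun i =>
          ∑ m ∈ Finset.Ico (κ i.succ) (κ i.castSucc),
            (fun j : Fin n => t ^ (κ i.castSucc - (m + 1)) * x j ^ m)) := by
      change _ = Matrix.det _
      congr 1
      ext i j
      simp [Finset.sum_apply]
    rw [e, this]
    apply Finset.sum_congr rfl
    intro μ _
    exact Matrix.det_mul_column (fun i => t ^ (κ i.castSucc - (μ i + 1)))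
      (Matrix.of fun i j : Fin n => x j ^ μ i)
  rw [h2, mul_left_comm, Finset.mul_sum]
  congr 1
  apply Finset.sum_congr rfl
  intro μ _
  rw [Fin.prod_univ_castSucc]
  simp only [lowf_castSucc, lowf_last, Nat.sub_zero]
  ring

/-- the branching polynomial -/
def Kt {K : Type} [Field K] {n : ℕ} (M : ℕ) (μ : Fin n → ℕ) (t : K) : K :=
  ∏ i, ∑ k ∈ Finset.Icc (lowf μ i) (upf M μ i), t ^ (k - lowf μ i)

theorem fs_ext {K : Type} [Field K] {n : ℕ} (x : Fin n → K) (t : K) (M : ℕ) :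
    fs (extv x t) (M + 1) = (∏ j, (x j - t)) * ∑ μ ∈ SC n M, Kt M μ t * alt x μ := by
  unfold fs
  rw [Finset.sum_congr rfl fun κ hκ => alt_ext x t κ (mem_SC.1 hκ).2, ← Finset.mul_sum]
  congr 1
  rw [Finset.sum_comm' (t' := SC n M)
    (s' := fun μ => Fintype.piFinset fun i => Finset.Icc (lowf μ i) (upf M μ i))]
  · apply Finset.sum_congr rfl
    intro μ _
    rw [← Finset.sum_mul, Kt, Finset.prod_univ_sum]
  · intro κ μ
    simp only [mem_SC, Fintype.mem_piFinset, Finset.mem_Ico, Finset.mem_Icc]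
    constructor
    · rintro ⟨⟨h1, h2⟩, h3⟩
      refine ⟨fun i => ⟨?_, ?_⟩, fun i => ?_, fun i j hij => ?_⟩
      · induction i using Fin.lastCases with
        | last => simp
        | cast i => simpa using (h3 i).2
      · induction i using Fin.cases with
        | zero => simpa using Nat.lt_succ_iff.1 (h1 0)
        | succ i => simpa using (h3 i).1
      · have := (h3 i).2
        have := h1 i.castSucc
        omega
      · have a1 := (h3 j).2
        have a2 := (h3 i).1
        have a3 : κ j.castSucc ≤ κ i.succ := h2.antitone (Fin.succ_le_castSucc_iff.2 hij)
        omega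
    · rintro ⟨h1, h2, h3⟩
      have b1 : ∀ i : Fin n, μ i + 1 ≤ κ i.castSucc := fun i => by simpa using (h1 i.castSucc).1
      have b2 : ∀ i : Fin n, κ i.succ ≤ μ i := fun i => by simpa using (h1 i.succ).2
      refine ⟨⟨fun i => ?_, ?_⟩, fun i => ⟨b2 i, b1 i⟩⟩
      · induction i using Fin.cases with
        | zero => have := (h1 0).2; rw [upf_zero] at this; omega
        | succ i => have := b2 i; have := h2 i; omega
      · rw [Fin.strictAnti_iff_succ_lt]
        intro i
        have := b1 i
        have := b2 i
        omega

/-! ### Part D: a Christoffel-Darboux type identity -/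

/-- `z ^ a - z ^ (N - a)` -/
def phi {K : Type} [Field K] (N a : ℕ) (z : K) : K := z ^ a - z ^ (N - a)

theorem phi_step {K : Type} [Field K] (N a : ℕ) (h : a ≤ N) (t z : K) :
    (t - z) * (1 - t * z) * phi N a z =
      t * phi (N + 2) a z - (1 + t ^ 2) * phi (N + 2) (a + 1) z + t * phi (N + 2) (a + 2) z := by
  obtain ⟨b, rfl⟩ := Nat.exists_eq_add_of_le h
  unfold phi
  have e1 : a + b - a = b := by omega
  have e2 : a + b + 2 - a = b + 2 := by omega
  have e3 : a + b + 2 - (a + 1) = b + 1 := by omega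
  have e4 : a + b + 2 - (a + 2) = b := by omega
  rw [e1, e2, e3, e4]
  ring

theorem phi_sum {K : Type} [Field K] (N k q : ℕ) (h : k + q ≤ N + 1) (t z : K) :
    (t - z) * (1 - t * z) * ∑ p ∈ Finset.range q, t ^ p * phi N (k + p) z =
      - (phi (N + 2) (k + 1) z - t * phi (N + 2) k z) +
        t ^ q * (phi (N + 2) (k + q + 1) z - t * phi (N + 2) (k + q) z) := by
  induction q with
  | zero => simp
  | succ q ih =>
    rw [Finset.sum_range_succ, mul_add, ih (by omega)]
    have := phi_step N (k + q) (by omega) t z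
    have e : k + (q + 1) = k + q + 1 := by omega
    rw [e]
    linear_combination t ^ q * this

theorem phi_sum' {K : Type} [Field K] (C k : ℕ) (t z : K) :
    (t - z) * (1 - t * z) * ∑ p ∈ Finset.range (C + 2), t ^ p * phi (C + 2 * k + 1) (k + p) z =
      t * (1 - t ^ (C + 1)) * phi (C + 2 * k + 3) k z
        - (1 - t ^ (C + 3)) * phi (C + 2 * k + 3) (k + 1) z := by
  rw [phi_sum _ _ _ (by omega)]
  unfold phi
  have e1 : C + 2 * k + 1 + 2 - (k + 1) = C + k + 2 := by omega
  have e2 : C + 2 * k + 1 + 2 - k = C + k + 3 := by omega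
  have e3 : C + 2 * k + 1 + 2 - (k + (C + 2) + 1) = k := by omega
  have e4 : C + 2 * k + 1 + 2 - (k + (C + 2)) = k + 1 := by omega
  have e5 : C + 2 * k + 3 - k = C + k + 3 := by omega
  have e6 : C + 2 * k + 3 - (k + 1) = C + k + 2 := by omega
  rw [e1, e2, e3, e4]
  ring

/-- numerator determinants -/
def DP {K : Type} [Field K] {k : ℕ} (x : Fin (k + 1) → K) (C p : ℕ) : K :=
  Matrix.det (Matrix.updateRow (Matrix.of fun i j : Fin (k + 1) => phi (C + 2 * k + 1) i (x j))
    (Fin.last k) (fun j => phi (C + 2 * k + 1) (k + p) (x j)))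

theorem sum_single {K : Type} [Field K] {m c : ℕ} (hc : c < m) (r : K) (g : ℕ → K) :
    ∑ b : Fin m, (if (b : ℕ) = c then r else 0) * g b = r * g c := by
  rw [Finset.sum_eq_single (⟨c, hc⟩ : Fin m)]
  · simp
  · intro b _ hb
    have : (b : ℕ) ≠ c := fun h => hb (Fin.ext h)
    simp [this]
  · simp

def Tm {K : Type} [Field K] (k C : ℕ) (t : K) : Matrix (Fin (k + 2)) (Fin (k + 2)) K :=
  Matrix.of fun a b =>
    if (a : ℕ) < k then (if (b : ℕ) = a then t else 0) +
        (if (b : ℕ) = a + 1 then -(1 + t ^ 2) else 0) + (if (b : ℕ) = a + 2 then t else 0)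
    else if (a : ℕ) = k then (if (b : ℕ) = k then t * (1 - t ^ (C + 1)) else 0) +
        (if (b : ℕ) = k + 1 then -(1 - t ^ (C + 3)) else 0)
    else (if (b : ℕ) = k + 1 then 1 else 0)

theorem Tm_det {K : Type} [Field K] (k C : ℕ) (t : K) :
    (Tm k C t).det = t ^ k * (t * (1 - t ^ (C + 1))) := by
  rw [Matrix.det_of_upperTriangular]
  · rw [Fin.prod_univ_castSucc, Fin.prod_univ_castSucc]
    have h1 : ∀ i : Fin k, Tm k C t i.castSucc.castSucc i.castSucc.castSucc = t := by
      intro i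
      simp [Tm]
    simp only [h1]
    simp [Tm]
  · intro a b hab
    have hab' : (b : ℕ) < a := hab
    have ha := a.2
    simp only [Tm, Matrix.of_apply]
    split_ifs <;> first | omega | simp

theorem cd_identity {K : Type} [Field K] {k : ℕ} (x : Fin (k + 1) → K) (C : ℕ) (t : K)
    (ht : t ≠ 0) (ht1 : t ^ (C + 1) ≠ 1) :
    Dd (extv x t) (fun i => extv x t i ^ (C + k + 2)) =
      (∏ j, ((t - x j) * (1 - t * x j))) * ∑ p ∈ Finset.range (C + 2), t ^ p * DP x C p := by
  let P : Matrix (Fin (k + 2)) (Fin (k + 2)) K :=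
    Matrix.of fun a j => phi (C + 2 * k + 3) a (extv x t j)
  have hD : Dd (extv x t) (fun i => extv x t i ^ (C + k + 2)) = P.det := by
    rw [← Matrix.det_transpose]
    unfold Dd
    congr 1
    ext i j
    simp only [Matrix.of_apply, Matrix.transpose_apply, P, phi, ← pow_add, Fin.val_rev]
    have : C + k + 2 + (k + 1 + 1 - (↑j + 1)) = C + 2 * k + 3 - j := by have := j.2; omega
    rw [this]
  have hmul : ∀ a j, (Tm k C t * P) a j =
      if (a : ℕ) < k then (t - extv x t j) * (1 - t * extv x t j) *
        phi (C + 2 * k + 1) a (extv x t j)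
      else if (a : ℕ) = k then (t - extv x t j) * (1 - t * extv x t j) *
        ∑ p ∈ Finset.range (C + 2), t ^ p * phi (C + 2 * k + 1) (k + p) (extv x t j)
      else phi (C + 2 * k + 3) (k + 1) (extv x t j) := by
    intro a j
    rw [Matrix.mul_apply]
    simp only [Tm, P, Matrix.of_apply]
    by_cases h1 : (a : ℕ) < k
    · simp only [h1, if_true, add_mul, Finset.sum_add_distrib]
      rw [sum_single (by omega) _ (fun b => phi (C + 2 * k + 3) b (extv x t j)),
        sum_single (by omega) _ (fun b => phi (C + 2 * k + 3) b (extv x t j)),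
        sum_single (by omega) _ (fun b => phi (C + 2 * k + 3) b (extv x t j)),
        phi_step _ _ (by omega)]
      ring
    · by_cases h2 : (a : ℕ) = k
      · simp only [h2, lt_irrefl, if_false, if_true, add_mul, Finset.sum_add_distrib]
        rw [sum_single (by omega) _ (fun b => phi (C + 2 * k + 3) b (extv x t j)),
          sum_single (by omega) _ (fun b => phi (C + 2 * k + 3) b (extv x t j)), phi_sum']
        ring
      · simp only [h1, h2, if_false]
        rw [sum_single (by omega) _ (fun b => phi (C + 2 * k + 3) b (extv x t j)), one_mul]
  have h0 : ∀ i : Fin (k + 1), (Tm k C t * P) i.castSucc (Fin.last (k + 1)) = 0 := by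
    intro i
    rw [hmul, extv_last]
    have := i.2
    by_cases h1 : (i : ℕ) < k
    · simp [h1]
    · have h2 : (i : ℕ) = k := by omega
      simp [h2]
  have hdet := det_last_col _ h0
  have hsub : (Tm k C t * P).submatrix Fin.castSucc Fin.castSucc =
      Matrix.of fun i j => ((t - x j) * (1 - t * x j)) *
        (Matrix.updateRow (Matrix.of fun i j : Fin (k + 1) => phi (C + 2 * k + 1) i (x j))
          (Fin.last k) (∑ p ∈ Finset.range (C + 2), t ^ p •
            (fun j => phi (C + 2 * k + 1) (k + p) (x j)))) i j := by
    ext i j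
    rw [Matrix.submatrix_apply, hmul, extv_castSucc, Matrix.of_apply, Fin.val_castSucc]
    induction i using Fin.lastCases with
    | last => simp [Finset.sum_apply]
    | cast i =>
      rw [Matrix.updateRow_ne (Fin.castSucc_lt_last i).ne]
      simp
  have hsum : Matrix.det (Matrix.updateRow (Matrix.of fun i j : Fin (k + 1) =>
        phi (C + 2 * k + 1) i (x j)) (Fin.last k) (∑ p ∈ Finset.range (C + 2), t ^ p •
            (fun j => phi (C + 2 * k + 1) (k + p) (x j)))) =
      ∑ p ∈ Finset.range (C + 2), t ^ p * DP x C p := by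
    have := (Matrix.detRowAlternating (n := Fin (k + 1)) (R := K)).toMultilinearMap.map_update_sum
      (Finset.range (C + 2)) (Fin.last k)
      (fun p => t ^ p • (fun j => phi (C + 2 * k + 1) (k + p) (x j)))
      (fun i j : Fin (k + 1) => phi (C + 2 * k + 1) i (x j))
    refine Eq.trans this ?_
    apply Finset.sum_congr rfl
    intro p _
    exact Matrix.det_updateRow_smul _ _ _ _
  rw [hsub, Matrix.det_mul_row, hsum, Matrix.det_mul, Tm_det, hmul, ← hD, extv_last] at hdet
  have e : phi (C + 2 * k + 3) (k + 1) t = t ^ k * (t * (1 - t ^ (C + 1))) := by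
    unfold phi
    have : C + 2 * k + 3 - (k + 1) = k + 1 + (C + 1) := by omega
    rw [this]
    ring
  simp only [Fin.val_last, show ¬ (k + 1 < k) by omega, show ¬ (k + 1 = k) by omega, if_false,
    e] at hdet
  refine mul_left_cancel₀ ?_ hdet
  exact mul_ne_zero (pow_ne_zero _ ht) (mul_ne_zero ht (sub_ne_zero.2 ht1.symm))


section stepE
variable {K : Type} [Field K]

theorem pp_castSucc {n : ℕ} (f : Fin (n + 1) → Fin (n + 1) → K) :
    pp univ f = pp univ (fun i j : Fin n => f i.castSucc j.castSucc) *
      ∏ i : Fin n, f i.castSucc (Fin.last n) := by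
  unfold pp
  rw [Fin.prod_univ_castSucc]
  have h1 : (∏ j : Fin (n + 1), if Fin.last n < j then f (Fin.last n) j else 1) = 1 := by
    apply Finset.prod_eq_one
    intro j _
    rw [if_neg]
    exact not_lt.mpr (Fin.le_last j)
  rw [h1, mul_one, ← Finset.prod_mul_distrib]
  apply Finset.prod_congr rfl
  intro i _
  rw [Fin.prod_univ_castSucc]
  simp [Fin.castSucc_lt_last]

theorem Vd_ext {n : ℕ} (x : Fin n → K) (t : K) :
    Vd (extv x t) = Vd x * ∏ j, (x j - t) := by
  simp [Vd, pp_castSucc]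

theorem Vp_ext {n : ℕ} (x : Fin n → K) (t : K) :
    Vp (extv x t) = Vp x * ∏ j, (t - x j) := by
  simp [Vp, pp_castSucc]

theorem EE_ext {n : ℕ} (x : Fin n → K) (t : K) :
    EE (extv x t) = EE x * (1 - t) * ∏ j, (1 - x j * t) := by
  simp only [EE, pp_castSucc, Fin.prod_univ_castSucc, extv_castSucc, extv_last]
  ring

theorem Gen_ext {n : ℕ} {x : Fin n → K} (hx : Gen x) {t : K} (h1 : t ≠ 1) (h2 : t ≠ -1)
    (h3 : ∀ i, x i ≠ t) (h4 : ∀ i, x i * t ≠ 1) : Gen (extv x t) := by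
  refine ⟨?_, ?_, ?_, ?_⟩
  · intro i j
    refine Fin.lastCases ?_ (fun i => ?_) i <;> refine Fin.lastCases ?_ (fun j => ?_) j
    · simp
    · intro _; simpa using (h3 j).symm
    · intro _; simpa using (h3 i)
    · intro h; simpa using hx.inj i j (fun e => h (by rw [e]))
  · intro i
    refine Fin.lastCases ?_ (fun i => ?_) i
    · simpa using h1
    · simpa using hx.one i
  · intro i
    refine Fin.lastCases ?_ (fun i => ?_) i
    · simpa using h2
    · simpa using hx.neg i
  · intro i j
    refine Fin.lastCases ?_ (fun i => ?_) i <;> refine Fin.lastCases ?_ (fun j => ?_) j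
    · simp
    · intro _; simpa [mul_comm] using (h4 j)
    · intro _; simpa using (h4 i)
    · intro h; simpa using hx.mul i j (fun e => h (by rw [e]))

theorem comb_pt {k : ℕ} {x : Fin (k + 1) → K} (hx : Gen x) (C : ℕ) {t : K} (h0 : t ≠ 0)
    (hC : t ^ (C + 1) ≠ 1) (h2 : t ≠ -1)
    (h3 : ∀ i, x i ≠ t) (h4 : ∀ i, x i * t ≠ 1) :
    (∑ p ∈ range (C + 2), t ^ p * DP x C p) * Vd x =
      EE x * Vp x * ((1 - t) * ∑ μ ∈ SC (k + 1) (C + k + 1), Kt (C + k + 1) μ t * alt x μ) := by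
  have h1 : t ≠ 1 := by
    rintro rfl
    simp at hC
  have hg := Gen_ext hx h1 h2 h3 h4
  have e1 := Dd_eq hg (C + k + 2)
  have e2 := fs_eq hg (C + k + 1 + 1)
  rw [cd_identity x C t h0 hC] at e1
  rw [fs_ext, Vd_ext] at e2
  rw [EE_ext, Vp_ext] at e1
  have hP : ∏ j, (x j - t) ≠ 0 := Finset.prod_ne_zero_iff.mpr fun j _ => sub_ne_zero.mpr (h3 j)
  have hP' : ∏ j, (t - x j) ≠ 0 :=
    Finset.prod_ne_zero_iff.mpr fun j _ => sub_ne_zero.mpr (h3 j).symm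
  have hQ : ∏ j, (1 - x j * t) ≠ 0 :=
    Finset.prod_ne_zero_iff.mpr fun j _ => sub_ne_zero.mpr (h4 j).symm
  rw [Finset.prod_mul_distrib] at e1
  have hQ' : ∏ j, (1 - t * x j) = ∏ j, (1 - x j * t) :=
    Finset.prod_congr rfl fun j _ => by rw [mul_comm]
  rw [hQ'] at e1
  have e3 : ∑ μ ∈ SC (k + 1) (C + k + 1), Kt (C + k + 1) μ t * alt x μ =
      Vd x * Psi (extv x t) univ (C + k + 2) := by
    apply mul_left_cancel₀ hP
    rw [e2]; ring
  have e4 : (∑ p ∈ range (C + 2), t ^ p * DP x C p) =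
      EE x * Vp x * (1 - t) * Psi (extv x t) univ (C + k + 2) := by
    apply mul_left_cancel₀ (mul_ne_zero hP' hQ)
    rw [e1]; ring
  rw [e3, e4]; ring

/-- Generating polynomial of the coefficients. -/
def HP {n : ℕ} (M : ℕ) (μ : Fin n → ℕ) : Polynomial ℤ :=
  (1 - Polynomial.X) *
    ∏ i, ∑ k ∈ Finset.Icc (lowf μ i) (upf M μ i), Polynomial.X ^ (k - lowf μ i)

theorem HP_eval {n : ℕ} (M : ℕ) (μ : Fin n → ℕ) (t : K) :
    ((HP M μ).map (Int.castRingHom K)).eval t = (1 - t) * Kt M μ t := by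
  simp [HP, Kt, Polynomial.eval_prod, Polynomial.eval_finsetSum, Polynomial.map_prod,
    Polynomial.map_sum]

theorem comb_coeff [Infinite K] {k : ℕ} {x : Fin (k + 1) → K} (hx : Gen x) (C p : ℕ)
    (hp : p < C + 2) :
    DP x C p * Vd x =
      EE x * Vp x * ∑ μ ∈ SC (k + 1) (C + k + 1),
        (((HP (C + k + 1) μ).coeff p : ℤ) : K) * alt x μ := by
  let P1 : Polynomial K := (∑ p ∈ range (C + 2), Polynomial.X ^ p * Polynomial.C (DP x C p)) *
    Polynomial.C (Vd x)
  let P2 : Polynomial K := Polynomial.C (EE x * Vp x) * ∑ μ ∈ SC (k + 1) (C + k + 1),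
    (HP (C + k + 1) μ).map (Int.castRingHom K) * Polynomial.C (alt x μ)
  let Q : Polynomial K := Polynomial.X * (Polynomial.X ^ (C + 1) - 1) * (Polynomial.X + 1) *
    (∏ i, (Polynomial.C (x i) - Polynomial.X)) * ∏ i, (Polynomial.C (x i) * Polynomial.X - 1)
  have hQ : Q ≠ 0 := by
    refine mul_ne_zero (mul_ne_zero (mul_ne_zero (mul_ne_zero Polynomial.X_ne_zero ?_) ?_) ?_) ?_
    · exact (Polynomial.monic_X_pow_sub_C (1 : K) (Nat.succ_ne_zero C)).ne_zero
    · exact (Polynomial.monic_X_add_C (1 : K)).ne_zero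
    · refine Finset.prod_ne_zero_iff.mpr fun i _ => ?_
      intro h
      have := congrArg (Polynomial.eval (x i + 1)) h
      simp at this
    · refine Finset.prod_ne_zero_iff.mpr fun i _ => ?_
      intro h
      have := congrArg (Polynomial.eval 0) h
      simp at this
  have key : P1 * Q = P2 * Q := by
    apply Polynomial.funext
    intro t
    rw [Polynomial.eval_mul (p := P1), Polynomial.eval_mul (p := P2)]
    by_cases hq : Q.eval t = 0
    · rw [hq, mul_zero, mul_zero]
    · congr 1
      simp only [Q, Polynomial.eval_mul, Polynomial.eval_prod, Polynomial.eval_sub,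
        Polynomial.eval_add, Polynomial.eval_X, Polynomial.eval_C, Polynomial.eval_pow,
        Polynomial.eval_one, mul_ne_zero_iff, Finset.prod_ne_zero_iff, ← ne_eq] at hq
      obtain ⟨⟨⟨⟨q1, q2⟩, q3⟩, q4⟩, q5⟩ := hq
      have := comb_pt hx C q1 (sub_ne_zero.mp q2) (fun h => q3 (by rw [h]; ring))
        (fun i => sub_ne_zero.mp (q4 i (Finset.mem_univ i)))
        (fun i => sub_ne_zero.mp (q5 i (Finset.mem_univ i)))
      simp only [P1, P2, Polynomial.eval_mul, Polynomial.eval_finsetSum, Polynomial.eval_C,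
        Polynomial.eval_pow, Polynomial.eval_X, HP_eval]
      rw [this, Finset.mul_sum]
      congr 1
      exact Finset.sum_congr rfl fun μ _ => by ring
  have h12 : P1 = P2 := mul_right_cancel₀ hQ key
  have hc := congrArg (fun P => Polynomial.coeff P p) h12
  simp only [P1, P2, Polynomial.coeff_mul_C, Polynomial.coeff_C_mul, Polynomial.finsetSum_coeff,
    Polynomial.coeff_map, Polynomial.coeff_X_pow] at hc
  simp only [ite_mul, one_mul, zero_mul, Finset.sum_ite_eq, Finset.mem_range, hp, if_true] at hc
  simpa using hc

end stepE

section stepF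

/-- Signed coefficients, by recursion. -/
def hc (C : ℕ) (ν : ℕ → ℕ) : ℕ → ℤ → ℤ
  | 0, q => (if q = 0 then 1 else 0) - (if q = (C : ℤ) - ν 0 + 1 then 1 else 0)
  | j + 1, q => ∑ r ∈ range (ν j - ν (j + 1) + 1), hc C ν j (q - r)

theorem hc_anti (C : ℕ) (ν : ℕ → ℕ) (hν : Antitone ν) (j : ℕ) :
    ∀ q : ℤ, hc C ν j q = - hc C ν j ((C : ℤ) - ν j + 1 - q) := by
  induction j with
  | zero =>
    intro q
    simp only [hc]
    have e1 : ((C : ℤ) - ν 0 + 1 - q = 0) ↔ (q = (C : ℤ) - ν 0 + 1) := by omega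
    have e2 : ((C : ℤ) - ν 0 + 1 - q = (C : ℤ) - ν 0 + 1) ↔ (q = 0) := by omega
    simp only [e1, e2]
    ring
  | succ j ih =>
    intro q
    simp only [hc]
    rw [← Finset.sum_range_reflect, ← Finset.sum_neg_distrib]
    refine Finset.sum_congr rfl fun r hr => ?_
    rw [ih]
    congr 2
    have := hν (Nat.le_succ j)
    rw [Finset.mem_range] at hr
    rw [Nat.succ_eq_add_one] at this
    omega

theorem hc_neg (C : ℕ) (ν : ℕ → ℕ) (h0 : ν 0 ≤ C) (j : ℕ) :
    ∀ q : ℤ, q < 0 → hc C ν j q = 0 := by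
  induction j with
  | zero =>
    intro q hq
    simp only [hc]
    rw [if_neg (by omega), if_neg (by omega)]; rfl
  | succ j ih =>
    intro q hq
    simp only [hc]
    exact Finset.sum_eq_zero fun r _ => ih _ (by omega)

/-- Ballot counts, by recursion. -/
def bc (C : ℕ) (ν : ℕ → ℕ) : ℕ → ℤ → ℤ
  | 0, q => (if q = 0 then 1 else 0)
  | j + 1, q => ∑ r ∈ range (ν j - ν (j + 1) + 1),
      if (ν j : ℤ) - r + 2 * q ≤ C then bc C ν j (q - r) else 0

theorem bc_eq_hc (C : ℕ) (ν : ℕ → ℕ) (hν : Antitone ν) (h0 : ν 0 ≤ C) (j : ℕ) :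
    ∀ q : ℤ, 2 * q ≤ (C : ℤ) - ν j → bc C ν j q = hc C ν j q := by
  induction j with
  | zero =>
    intro q hq
    simp only [hc, bc]
    rw [if_neg (c := q = (C : ℤ) - ν 0 + 1) (by omega)]; ring
  | succ j ih =>
    intro q hq
    simp only [hc, bc]
    have hle := hν (Nat.le_succ j)
    rw [Nat.succ_eq_add_one] at hle
    have h1 : ∀ r ∈ range (ν j - ν (j + 1) + 1),
        (if (ν j : ℤ) - r + 2 * q ≤ C then bc C ν j (q - r) else 0) =
        hc C ν j (q - r) - (if (ν j : ℤ) - r + 2 * q ≤ C then 0 else hc C ν j (q - r)) := by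
      intro r _
      split_ifs with h
      · rw [ih _ (by omega), sub_zero]
      · rw [sub_self]
    rw [Finset.sum_congr rfl h1, Finset.sum_sub_distrib, sub_eq_self]
    have h2 : ∑ r ∈ range (ν j - ν (j + 1) + 1),
        (if (ν j : ℤ) - r + 2 * q ≤ C then 0 else hc C ν j (q - r)) =
        ∑ r ∈ range ((ν j + 2 * q - C).toNat), hc C ν j (q - r) := by
      have hsub : range ((ν j + 2 * q - C).toNat) ⊆ range (ν j - ν (j + 1) + 1) := by
        intro r hr
        rw [Finset.mem_range] at *
        omega
      rw [← Finset.sum_subset hsub]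
      · refine Finset.sum_congr rfl fun r hr => ?_
        rw [Finset.mem_range] at hr
        rw [if_neg (by omega)]
      · intro r _ hr
        rw [Finset.mem_range] at hr
        rw [if_pos (by omega)]
    rw [h2]
    have h3 : ∑ r ∈ range ((ν j + 2 * q - C).toNat), hc C ν j (q - r) =
        - ∑ r ∈ range ((ν j + 2 * q - C).toNat), hc C ν j (q - r) := by
      conv_lhs => rw [← Finset.sum_range_reflect]
      rw [← Finset.sum_neg_distrib]
      refine Finset.sum_congr rfl fun r hr => ?_
      rw [hc_anti C ν hν]
      congr 2
      rw [Finset.mem_range] at hr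
      omega
    omega

/-- The counted sets. -/
def BS (C : ℕ) (ν : ℕ → ℕ) (j : ℕ) (q : ℤ) : Finset (Fin j → ℕ) :=
  (Fintype.piFinset fun _ : Fin j => Finset.range (C + 1)).filter fun ρ =>
    (∀ i : Fin j, ν (i + 1) ≤ ρ i ∧ ρ i ≤ ν i) ∧
    (∑ i : Fin j, ((ν i : ℤ) - ρ i)) = q ∧
    ∀ i : Fin j, (ρ i : ℤ) + 2 * ∑ i' : Fin j, (if i' ≤ i then (ν i' : ℤ) - ρ i' else 0) ≤ C

theorem BS_card (C : ℕ) (ν : ℕ → ℕ) (hν : Antitone ν) (h0 : ν 0 ≤ C) (j : ℕ) :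
    ∀ q : ℤ, ((BS C ν j q).card : ℤ) = bc C ν j q := by
  induction j with
  | zero =>
    intro q
    simp only [bc]
    by_cases hq : q = 0
    · have : BS C ν 0 q = univ := by
        apply Finset.eq_univ_of_forall
        intro ρ
        simp [BS, hq]
        exact Subsingleton.elim _ _
      rw [this, if_pos hq]
      simp
    · have : BS C ν 0 q = ∅ := by
        apply Finset.eq_empty_of_forall_notMem
        intro ρ
        simp [BS, Ne.symm hq]
      rw [this, if_neg hq]
      simp
  | succ j ih =>
    intro q
    simp only [bc]
    have hle := hν (Nat.le_succ j)
    rw [Nat.succ_eq_add_one] at hle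
    have hj0 : ν j ≤ ν 0 := hν (Nat.zero_le j)
    have hmaps : ∀ ρ ∈ BS C ν (j + 1) q, ν j - ρ (Fin.last j) ∈ range (ν j - ν (j + 1) + 1) := by
      intro ρ hρ
      simp only [BS, Finset.mem_filter] at hρ
      have := hρ.2.1 (Fin.last j)
      simp only [Fin.val_last] at this
      rw [Finset.mem_range]
      omega
    rw [Finset.card_eq_sum_card_fiberwise hmaps]
    push_cast
    refine Finset.sum_congr rfl fun r hr => ?_
    rw [Finset.mem_range] at hr
    split_ifs with hC
    · rw [← ih]
      norm_cast
      refine Finset.card_bij' (fun ρ _ => fun i : Fin j => ρ i.castSucc)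
        (fun ρ _ => (Fin.snoc ρ (ν j - r) : Fin (j + 1) → ℕ)) ?_ ?_ ?_ ?_
      · intro ρ hρ
        simp only [BS, Finset.mem_filter, Fintype.mem_piFinset, Fin.sum_univ_castSucc,
          Fin.forall_fin_succ', Fin.val_last, Fin.val_castSucc, Fin.castSucc_le_castSucc_iff] at hρ ⊢
        obtain ⟨⟨h1, h2, h3, h4, h5⟩, h6⟩ := hρ
        refine ⟨h1.1, h2.1, by omega, fun i => ?_⟩
        have := h4 i
        rw [if_neg (not_le.mpr (Fin.castSucc_lt_last i)), add_zero] at this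
        exact this
      · intro ρ hρ
        simp only [BS, Finset.mem_filter, Fintype.mem_piFinset, Fin.sum_univ_castSucc,
          Fin.forall_fin_succ', Fin.val_last, Fin.val_castSucc, Fin.castSucc_le_castSucc_iff,
          Fin.snoc_castSucc, Fin.snoc_last, Finset.mem_range] at hρ ⊢
        obtain ⟨h1, h2, h3, h4⟩ := hρ
        refine ⟨⟨⟨h1, by omega⟩, ⟨h2, by omega⟩, by omega, fun i => ?_, ?_⟩, by omega⟩
        · rw [if_neg (not_le.mpr (Fin.castSucc_lt_last i)), add_zero]
          exact h4 i
        · simp only [Fin.le_last, if_true]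
          rw [h3]
          omega
      · intro ρ hρ
        simp only [BS, Finset.mem_filter] at hρ
        have h1 := hρ.1.2.1 (Fin.last j)
        simp only [Fin.val_last] at h1
        have : ν j - r = ρ (Fin.last j) := by omega
        simp only [this]
        exact Fin.snoc_init_self ρ
      · intro ρ _
        exact Fin.init_snoc _ _
    · have : (BS C ν (j + 1) q).filter (fun ρ => ν j - ρ (Fin.last j) = r) = ∅ := by
        apply Finset.eq_empty_of_forall_notMem
        intro ρ hρ
        simp only [BS, Finset.mem_filter] at hρ
        have h1 := hρ.1.2.1 (Fin.last j)
        have h2 := hρ.1.2.2.2 (Fin.last j)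
        have h3 := hρ.1.2.2.1
        simp only [Fin.le_last, if_true] at h2
        rw [h3] at h2
        simp only [Fin.val_last] at h1
        apply hC
        omega
      rw [this]
      simp

/-- Extension by zero. -/
def ex0 {n : ℕ} (ν : Fin n → ℕ) (j : ℕ) : ℕ := if h : j < n then ν ⟨j, h⟩ else 0

theorem ex0_val {n : ℕ} (ν : Fin n → ℕ) (i : Fin n) : ex0 ν i = ν i := by
  simp [ex0]

theorem ex0_anti {n : ℕ} {ν : Fin n → ℕ} (hν : Antitone ν) : Antitone (ex0 ν) := by
  intro a b hab
  unfold ex0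
  split_ifs with h1 h2 h2
  · exact hν hab
  · omega
  · exact Nat.zero_le _
  · exact le_rfl

theorem bCoeff_eq_BS {n : ℕ} (C p : ℕ) {ν : Fin n → ℕ} (hν : Antitone ν) (hC : ∀ i, ν i ≤ C) :
    bCoeff n C p ν = (BS C (ex0 ν) n p).card := by
  unfold bCoeff BS
  congr 1
  apply Finset.filter_congr
  intro ρ hρ
  simp only [ex0_val]
  have hinter : (∀ i : Fin n, ex0 ν (i + 1) ≤ ρ i) ↔
      (∀ i j : Fin n, (i : ℕ) + 1 = (j : ℕ) → ν j ≤ ρ i) := by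
    constructor
    · intro h i j hij
      have := h i
      rwa [hij, ex0_val] at this
    · intro h i
      unfold ex0
      split_ifs with h1
      · exact h i ⟨i + 1, h1⟩ rfl
      · exact Nat.zero_le _
  -- facts under interlacing
  have hlt : (∀ i j : Fin n, (i : ℕ) + 1 = (j : ℕ) → ν j ≤ ρ i) →
      ∀ i j : Fin n, i < j → ν j ≤ ρ i := by
    intro h i j hij
    have h1 : (i : ℕ) + 1 < n := lt_of_le_of_lt (Nat.succ_le_of_lt hij) j.2
    exact (hν (show (⟨i + 1, h1⟩ : Fin n) ≤ j from Nat.succ_le_of_lt hij)).trans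
      (h i ⟨i + 1, h1⟩ rfl)
  have hsum : (∀ i, ρ i ≤ ν i) → ((∑ i : Fin n, (ν i - ρ i)) = p ↔
      (∑ i : Fin n, ((ν i : ℤ) - ρ i)) = p) := by
    intro h
    rw [← Nat.cast_inj (R := ℤ), Nat.cast_sum]
    have : ∀ i ∈ (univ : Finset (Fin n)), ((ν i - ρ i : ℕ) : ℤ) = (ν i : ℤ) - ρ i :=
      fun i _ => Nat.cast_sub (h i)
    rw [Finset.sum_congr rfl this]
  have hcell : (∀ i, ρ i ≤ ν i) → (∀ i j : Fin n, (i : ℕ) + 1 = (j : ℕ) → ν j ≤ ρ i) →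
      (∑ i : Fin n, ((ν i : ℤ) - ρ i)) = p → ∀ i : Fin n, ∀ j : ℕ, ρ i < j → j ≤ ν i →
      ((j : ℤ) < (C : ℤ) - 2 * (p : ℤ) +
          2 * ((∑ i' : Fin n,
            ((Finset.Ioc (ρ i') (ν i')).filter (fun j' => j' ≤ j)).card : ℤ)) ↔
        2 * (ρ i : ℤ) + 2 * ∑ i' : Fin n, (if i' ≤ i then (ν i' : ℤ) - ρ i' else 0) < C + j) := by
    intro h1 h2 h3 i j hj1 hj2
    have hc : ∀ i' : Fin n, (((Finset.Ioc (ρ i') (ν i')).filter (fun j' => j' ≤ j)).card : ℤ) =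
        ((ν i' : ℤ) - ρ i') - (if i' ≤ i then (ν i' : ℤ) - ρ i' else 0) +
          (if i' = i then (j : ℤ) - ρ i else 0) := by
      intro i'
      have e : (Finset.Ioc (ρ i') (ν i')).filter (fun j' => j' ≤ j) =
          Finset.Ioc (ρ i') (min (ν i') j) := by
        ext a
        simp only [Finset.mem_filter, Finset.mem_Ioc, le_min_iff]
        tauto
      rw [e, Nat.card_Ioc]
      rcases lt_trichotomy i' i with h | h | h
      · rw [if_pos h.le, if_neg h.ne]
        have := hlt h2 i' i h
        omega
      · subst h
        rw [if_pos le_rfl, if_pos rfl]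
        omega
      · rw [if_neg (not_le.mpr h), if_neg h.ne']
        have := hlt h2 i i' h
        have := h1 i'
        omega
    rw [Finset.sum_congr rfl fun i' _ => hc i', Finset.sum_add_distrib, Finset.sum_sub_distrib,
      h3, Finset.sum_ite_eq' univ i, if_pos (Finset.mem_univ i)]
    constructor <;> intro h <;> linarith
  constructor
  · rintro ⟨_, h1, h2, h3, h4⟩
    have h3' := (hsum h1).mp h3
    refine ⟨fun i => ⟨hinter.mpr h2 i, h1 i⟩, h3', ?_⟩
    have main : ∀ m : ℕ, ∀ hm : m < n, (ρ ⟨m, hm⟩ : ℤ) +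
        2 * ∑ i' : Fin n, (if i' ≤ ⟨m, hm⟩ then (ν i' : ℤ) - ρ i' else 0) ≤ C := by
      intro m
      induction m with
      | zero =>
        intro hm
        by_cases hr : ρ ⟨0, hm⟩ < ν ⟨0, hm⟩
        · have := (hcell h1 h2 h3' ⟨0, hm⟩ _ (Nat.lt_succ_self _) hr).mp
            (h4 ⟨0, hm⟩ _ (Nat.lt_succ_self _) hr)
          push_cast at this
          linarith
        · have hs : ∑ i' : Fin n, (if i' ≤ ⟨0, hm⟩ then (ν i' : ℤ) - ρ i' else 0) = 0 := by
            refine Finset.sum_eq_zero fun i' _ => ?_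
            split_ifs with hi
            · have : i' = ⟨0, hm⟩ := Fin.ext (Nat.le_zero.mp hi)
              subst this
              have := h1 ⟨0, hm⟩
              omega
            · rfl
          rw [hs]
          have := h1 ⟨0, hm⟩
          have := hC ⟨0, hm⟩
          omega
      | succ m ihm =>
        intro hm
        by_cases hr : ρ ⟨m + 1, hm⟩ < ν ⟨m + 1, hm⟩
        · have := (hcell h1 h2 h3' ⟨m + 1, hm⟩ _ (Nat.lt_succ_self _) hr).mp
            (h4 ⟨m + 1, hm⟩ _ (Nat.lt_succ_self _) hr)
          push_cast at this
          linarith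
        · have hm' : m < n := by omega
          have hs : ∑ i' : Fin n, (if i' ≤ ⟨m + 1, hm⟩ then (ν i' : ℤ) - ρ i' else 0) =
              ∑ i' : Fin n, (if i' ≤ ⟨m, hm'⟩ then (ν i' : ℤ) - ρ i' else 0) := by
            refine Finset.sum_congr rfl fun i' _ => ?_
            by_cases hi : i' = ⟨m + 1, hm⟩
            · subst hi
              have := h1 ⟨m + 1, hm⟩
              rw [if_pos le_rfl, if_neg (by simp [Fin.le_def])]
              omega
            · have : i' ≤ ⟨m + 1, hm⟩ ↔ i' ≤ ⟨m, hm'⟩ := by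
                simp only [Fin.le_def, Fin.ext_iff] at hi ⊢
                omega
              simp only [this]
          rw [hs]
          have e1 := ihm hm'
          have e2 := h1 ⟨m + 1, hm⟩
          have e3 := h2 ⟨m, hm'⟩ ⟨m + 1, hm⟩ rfl
          omega
    exact fun i => main i i.2
  · rintro ⟨h12, h3', h4⟩
    have h1 : ∀ i, ρ i ≤ ν i := fun i => (h12 i).2
    have h2 := hinter.mp fun i => (h12 i).1
    refine ⟨?_, h1, h2, (hsum h1).mpr h3', ?_⟩
    · intro a b hab
      rcases hab.eq_or_lt with h | h
      · rw [h]
      · exact (h1 b).trans (hlt h2 a b h)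
    · intro i j hj1 hj2
      rw [hcell h1 h2 h3' i j hj1 hj2]
      have := h4 i
      omega

theorem bCoeff_eq_hc {n : ℕ} (C p : ℕ) (hp : 2 * p ≤ C) (hn : 0 < n) {ν : Fin n → ℕ}
    (hν : Antitone ν) (hC : ∀ i, ν i ≤ C) :
    (bCoeff n C p ν : ℤ) = hc C (ex0 ν) n p := by
  have h0 : ex0 ν 0 ≤ C := by
    unfold ex0
    rw [dif_pos hn]
    exact hC _
  rw [bCoeff_eq_BS C p hν hC, BS_card C _ (ex0_anti hν) h0,
    bc_eq_hc C _ (ex0_anti hν) h0]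
  simp [ex0]
  omega

/-- Partial products. -/
def HQ (C : ℕ) (ν : ℕ → ℕ) (j : ℕ) : Polynomial ℤ :=
  (1 - Polynomial.X ^ (C - ν 0 + 1)) *
    ∏ i ∈ range j, ∑ r ∈ range (ν i - ν (i + 1) + 1), Polynomial.X ^ r

theorem HQ_coeff (C : ℕ) (ν : ℕ → ℕ) (h0 : ν 0 ≤ C) (j : ℕ) :
    ∀ p : ℕ, (HQ C ν j).coeff p = hc C ν j p := by
  induction j with
  | zero =>
    intro p
    simp only [HQ, hc, Finset.range_zero, Finset.prod_empty, mul_one, Polynomial.coeff_sub,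
      Polynomial.coeff_one, Polynomial.coeff_X_pow]
    have e : (p = C - ν 0 + 1) ↔ ((p : ℤ) = (C : ℤ) - ν 0 + 1) := by omega
    simp only [e, Nat.cast_eq_zero]
  | succ j ih =>
    intro p
    have : HQ C ν (j + 1) = ∑ r ∈ range (ν j - ν (j + 1) + 1), HQ C ν j * Polynomial.X ^ r := by
      unfold HQ
      rw [Finset.prod_range_succ, ← mul_assoc, Finset.mul_sum]
    rw [this, Polynomial.finsetSum_coeff]
    simp only [hc]
    refine Finset.sum_congr rfl fun r _ => ?_
    rw [Polynomial.coeff_mul_X_pow']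
    split_ifs with h
    · rw [ih, Nat.cast_sub h]
    · rw [hc_neg C ν h0]
      omega

theorem sum_Icc_pow (a b : ℕ) (_ : a ≤ b + 1) :
    ∑ k ∈ Finset.Icc a b, (Polynomial.X : Polynomial ℤ) ^ (k - a) =
      ∑ r ∈ range (b + 1 - a), Polynomial.X ^ r := by
  rw [← Finset.Ico_add_one_right_eq_Icc, Finset.sum_Ico_eq_sum_range]
  simp

theorem HP_eq {k : ℕ} (C : ℕ) {ν : Fin (k + 1) → ℕ} (hν : Antitone ν) (hC : ∀ i, ν i ≤ C) :
    HP (C + k + 1) (fun i => ν i + (k - (i : ℕ))) = HQ C (ex0 ν) (k + 1) := by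
  unfold HP HQ
  have hA := ex0_anti hν
  rw [Fin.prod_univ_succ, ← mul_assoc]
  congr 1
  · have hlow : lowf (fun i : Fin (k + 1) => ν i + (k - (i : ℕ))) 0 = ν 0 + k + 1 := by
      rw [← Fin.castSucc_zero, lowf_castSucc]
      simp
    rw [hlow, upf_zero, sum_Icc_pow _ _ (by have := hC 0; omega)]
    have : C + k + 1 + 1 - (ν 0 + k + 1) = C - ex0 ν 0 + 1 := by
      have := hC 0
      have h2 : ex0 ν 0 = ν 0 := ex0_val ν 0
      omega
    rw [this]
    exact mul_neg_geom_sum _ _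
  · rw [← Fin.prod_univ_eq_prod_range
      (fun i => ∑ r ∈ range (ex0 ν i - ex0 ν (i + 1) + 1), (Polynomial.X : Polynomial ℤ) ^ r)]
    refine Finset.prod_congr rfl fun i _ => ?_
    rw [upf_succ]
    refine Fin.lastCases ?_ (fun i => ?_) i
    · rw [Fin.succ_last, lowf_last, sum_Icc_pow _ _ (by omega), ex0_val]
      have h1 : ex0 ν ((Fin.last k : Fin (k + 1)) + 1 : ℕ) = 0 := by
        simp [ex0]
      rw [h1]
      simp
    · have h2 : ν i.succ ≤ ν i.castSucc := hν (Fin.castSucc_lt_succ).le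
      have h3 := i.2
      have h4 : ex0 ν ((i.castSucc : ℕ) + 1) = ν i.succ := ex0_val ν i.succ
      rw [Fin.succ_castSucc, lowf_castSucc, sum_Icc_pow _ _ (by simp; omega), ex0_val, h4]
      have h5 : ν i.castSucc + (k - (i.castSucc : ℕ)) + 1 - (ν i.succ + (k - (i.succ : ℕ)) + 1) =
          ν i.castSucc - ν i.succ + 1 := by
        simp only [Fin.val_castSucc, Fin.val_succ]
        omega
      rw [h5]

theorem bCoeff_eq_HP {k : ℕ} (C p : ℕ) (hp : 2 * p ≤ C) {ν : Fin (k + 1) → ℕ}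
    (hν : Antitone ν) (hC : ∀ i, ν i ≤ C) :
    (bCoeff (k + 1) C p ν : ℤ) =
      (HP (C + k + 1) (fun i => ν i + (k - (i : ℕ)))).coeff p := by
  rw [HP_eq C hν hC, HQ_coeff, bCoeff_eq_hc C p hp (Nat.succ_pos k) hν hC]
  exact (ex0_val ν 0).trans_le (hC 0)

end stepF

section stepG
variable {K : Type} [Field K]

/-- Complete homogeneous sums indexed by naturals. -/
def hn {R : Type} [CommRing R] {N : ℕ} (x : Fin N → R) (m : ℕ) : R :=
  ∑ f ∈ Finset.univ.filter (fun f : Fin m → Fin N => Monotone f), ∏ i, x (f i)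

theorem hpoly_nat {R : Type} [CommRing R] {N : ℕ} (x : Fin N → R) (m : ℕ) :
    hpoly x (m : ℤ) = hn x m := by
  simp [hpoly, hn]

theorem hpoly_neg {R : Type} [CommRing R] {N : ℕ} (x : Fin N → R) (m : ℤ) (hm : m < 0) :
    hpoly x m = 0 := by
  simp [hpoly, hm]

theorem hn_zero {R : Type} [CommRing R] {N : ℕ} (x : Fin N → R) : hn x 0 = 1 := by
  have : (Finset.univ.filter (fun f : Fin 0 → Fin N => Monotone f)) = Finset.univ := by
    apply Finset.filter_true_of_mem
    intro f _ a
    exact a.elim0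
  rw [hn, this]
  simp

theorem hn_rec {R : Type} [CommRing R] {N : ℕ} (x : Fin (N + 1) → R) (m : ℕ) :
    hn x (m + 1) = hn (fun i => x i.succ) (m + 1) + x 0 * hn x m := by
  have hsplit := Finset.sum_filter_add_sum_filter_not
    (Finset.univ.filter (fun f : Fin (m + 1) → Fin (N + 1) => Monotone f))
    (fun f => f 0 = 0) (fun f => ∏ i, x (f i))
  unfold hn
  rw [← hsplit, add_comm]
  congr 1
  · symm
    refine Finset.sum_bij (fun g _ => fun i => (g i).succ) ?_ ?_ ?_ ?_
    · intro g hg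
      simp only [Finset.mem_filter, Finset.mem_univ, true_and] at hg ⊢
      refine ⟨fun a b hab => Fin.succ_le_succ_iff.mpr (hg hab), Fin.succ_ne_zero _⟩
    · intro g _ g' _ h
      funext i
      exact Fin.succ_injective _ (congrFun h i)
    · intro f hf
      simp only [Finset.mem_filter, Finset.mem_univ, true_and] at hf
      have hne : ∀ i, f i ≠ 0 := by
        intro i h
        apply hf.2
        have := hf.1 (Fin.zero_le i)
        rw [h] at this
        exact Fin.le_zero_iff.mp this
      refine ⟨fun i => (f i).pred (hne i), ?_, ?_⟩
      · simp only [Finset.mem_filter, Finset.mem_univ, true_and]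
        intro a b hab
        exact Fin.pred_le_pred_iff.mpr (hf.1 hab)
      · funext i
        simp
    · intro g _
      rfl
  · rw [Finset.mul_sum]
    symm
    refine Finset.sum_bij (fun g _ => (Fin.cons 0 g : Fin (m + 1) → Fin (N + 1))) ?_ ?_ ?_ ?_
    · intro g hg
      simp only [Finset.mem_filter, Finset.mem_univ, true_and] at hg ⊢
      refine ⟨?_, by simp⟩
      intro a b
      refine Fin.cases ?_ (fun a => ?_) a
      · intro _; simp
      · refine Fin.cases ?_ (fun b => ?_) b
        · intro h
          exact absurd h (by simp)
        · intro h
          simpa using hg (Fin.succ_le_succ_iff.mp h)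
    · intro g _ g' _ h
      funext i
      have := congrFun h i.succ
      simpa using this
    · intro f hf
      simp only [Finset.mem_filter, Finset.mem_univ, true_and] at hf
      refine ⟨fun i => f i.succ, ?_, ?_⟩
      · simp only [Finset.mem_filter, Finset.mem_univ, true_and]
        intro a b hab
        exact hf.1 (Fin.succ_le_succ_iff.mpr hab)
      · funext i
        refine Fin.cases ?_ (fun i => ?_) i
        · simp [hf.2]
        · simp
    · intro g _
      rw [Fin.prod_univ_succ]
      simp

/-- Lagrange type sums. -/
def GG {n : ℕ} (x : Fin n → K) (e : ℕ) : K :=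
  ∑ k, x k ^ e / ∏ i ∈ univ.erase k, (x k - x i)

theorem GG_low {n : ℕ} {x : Fin (n + 1) → K} (hx : Function.Injective x) (e : ℕ) (he : e ≤ n) :
    GG x e = if e = n then 1 else 0 := by
  have h := Lagrange.coeff_eq_sum (s := (univ : Finset (Fin (n + 1)))) (v := x)
    (P := (Polynomial.X ^ e : Polynomial K)) hx.injOn (by
      rw [Polynomial.degree_X_pow, Finset.card_univ, Fintype.card_fin]
      exact_mod_cast Nat.lt_succ_of_le he)
  simp only [Finset.card_univ, Fintype.card_fin, Polynomial.coeff_X_pow, Polynomial.eval_pow,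
    Polynomial.eval_X, Nat.add_sub_cancel] at h
  rw [GG, ← h]
  simp [eq_comm]

theorem GG_rec {n : ℕ} {x : Fin (n + 1) → K} (hx : Function.Injective x) (e : ℕ) :
    GG x (e + 1) = GG (fun i => x i.succ) e + x 0 * GG x e := by
  unfold GG
  rw [← sub_eq_iff_eq_add, Finset.mul_sum, ← Finset.sum_sub_distrib, Fin.sum_univ_succ]
  have h0 : x 0 ^ (e + 1) / ∏ i ∈ univ.erase 0, (x 0 - x i) -
      x 0 * (x 0 ^ e / ∏ i ∈ univ.erase 0, (x 0 - x i)) = 0 := by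
    rw [pow_succ]; ring
  rw [h0, zero_add]
  apply Finset.sum_congr rfl
  intro k _
  have h1 : ∏ i ∈ univ.erase k.succ, (x k.succ - x i) =
      (x k.succ - x 0) * ∏ i ∈ univ.erase k, (x k.succ - x i.succ) := by
    have : (univ.erase k.succ : Finset (Fin (n + 1))) =
        insert 0 ((univ.erase k).map (Fin.succEmb n)) := by
      ext i
      refine Fin.cases ?_ (fun i => ?_) i
      · simp [(Fin.succ_ne_zero k).symm]
      · simp
    rw [this, Finset.prod_insert (by simp), Finset.prod_map]
    rfl
  rw [h1]
  have h2 : x k.succ - x 0 ≠ 0 := sub_ne_zero.mpr fun h => Fin.succ_ne_zero k (hx h)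
  have h3 : ∏ i ∈ univ.erase k, (x k.succ - x i.succ) ≠ 0 := by
    refine Finset.prod_ne_zero_iff.mpr fun i hi => sub_ne_zero.mpr fun h => ?_
    exact (Finset.ne_of_mem_erase hi) (Fin.succ_injective _ (hx h)).symm
  field_simp
  ring

theorem hn_GG {n : ℕ} : ∀ {x : Fin n → K}, Function.Injective x → ∀ m,
    hn x (m + 1) = GG x (m + n) := by
  induction n with
  | zero =>
    intro x _ m
    have : (Finset.univ.filter (fun f : Fin (m + 1) → Fin 0 => Monotone f)) = ∅ := by
      ext f
      exact (f 0).elim0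
    rw [hn, this]
    simp [GG]
  | succ n ih =>
    intro x hx m
    have hx' : Function.Injective (fun i : Fin n => x i.succ) :=
      hx.comp (Fin.succ_injective n)
    induction m with
    | zero =>
      rw [hn_rec, ih hx', hn_zero, zero_add, zero_add, GG_rec hx, GG_low hx n le_rfl, if_pos rfl]
    | succ m ihm =>
      rw [hn_rec, ih hx', ihm, show m + 1 + (n + 1) = (m + 1 + n) + 1 by ring, GG_rec hx,
        show m + (n + 1) = m + 1 + n by ring]

theorem hpoly_GG {n : ℕ} {x : Fin (n + 1) → K} (hx : Function.Injective x) (e : ℕ) :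
    hpoly x ((e : ℤ) - n) = GG x e := by
  rcases lt_trichotomy e n with h | h | h
  · rw [hpoly_neg _ _ (by omega), GG_low hx e h.le, if_neg h.ne]
  · subst h
    rw [GG_low hx e le_rfl, if_pos rfl, sub_self]
    exact (hpoly_nat x 0).trans (hn_zero x)
  · obtain ⟨m, rfl⟩ := Nat.exists_eq_add_of_lt h
    rw [show ((n + m + 1 : ℕ) : ℤ) - n = ((m + 1 : ℕ) : ℤ) by push_cast; ring, hpoly_nat,
      hn_GG hx, show m + (n + 1) = n + m + 1 by ring]

theorem prod_erase_eq {n : ℕ} (x : Fin n → K) :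
    ∏ k, ∏ i ∈ univ.erase k, (x k - x i) = Vp x * Vd x := by
  have h1 : Vp x = ∏ i, ∏ j, if j < i then x i - x j else 1 := by
    unfold Vp pp
    rw [Finset.prod_comm]
  have h2 : Vd x = ∏ i, ∏ j, if i < j then x i - x j else 1 := rfl
  rw [h1, h2, ← Finset.prod_mul_distrib]
  refine Finset.prod_congr rfl fun k _ => ?_
  rw [← Finset.prod_mul_distrib, ← Finset.mul_prod_erase univ _ (Finset.mem_univ k)]
  simp only [lt_self_iff_false, if_false, one_mul]
  refine Finset.prod_congr rfl fun i hi => ?_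
  have := Finset.ne_of_mem_erase hi
  rcases lt_or_gt_of_ne this with h | h
  · simp [h, h.not_gt]
  · simp [h, h.not_gt]

theorem schur_alt {n : ℕ} {x : Fin (n + 1) → K} (hx : Function.Injective x)
    (ν : Fin (n + 1) → ℕ) :
    schur (fun i => (ν i : ℤ)) x * Vd x = alt x (fun i => ν i + (n - (i : ℕ))) := by
  have hE : ∏ k, ∏ i ∈ univ.erase k, (x k - x i) ≠ 0 := by
    refine Finset.prod_ne_zero_iff.mpr fun k _ => Finset.prod_ne_zero_iff.mpr fun i hi =>
      sub_ne_zero.mpr fun h => ?_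
    exact (Finset.ne_of_mem_erase hi) (hx h).symm
  have hM : (Matrix.of fun i j : Fin (n + 1) =>
      hpoly x ((ν i : ℤ) - ((i : ℕ) : ℤ) + ((j : ℕ) : ℤ))) =
      (Matrix.of fun i k : Fin (n + 1) => x k ^ (ν i + (n - (i : ℕ)))) *
      Matrix.diagonal (fun k => (∏ i ∈ univ.erase k, (x k - x i))⁻¹) *
      Matrix.vandermonde x := by
    ext i j
    have hi : (i : ℕ) ≤ n := Nat.lt_succ_iff.mp i.2
    rw [Matrix.mul_apply, Matrix.of_apply,
      show (ν i : ℤ) - ((i : ℕ) : ℤ) + ((j : ℕ) : ℤ) =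
        ((ν i + (n - (i : ℕ)) + (j : ℕ) : ℕ) : ℤ) - n by push_cast [hi]; ring,
      hpoly_GG hx]
    refine Finset.sum_congr rfl fun k _ => ?_
    rw [Matrix.mul_diagonal, Matrix.of_apply, Matrix.vandermonde_apply, pow_add, div_eq_mul_inv]
    ring
  unfold schur
  rw [hM, Matrix.det_mul, Matrix.det_mul, Matrix.det_diagonal, Matrix.det_vandermonde,
    Finset.prod_inv_distrib]
  have hv : ∏ i : Fin (n + 1), ∏ j ∈ Ioi i, (x j - x i) = Vp x := by
    unfold Vp
    rw [pp_univ]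
  rw [hv]
  rw [prod_erase_eq] at hE ⊢
  change alt x _ * _ * _ * _ = _
  rw [mul_assoc, mul_assoc, inv_mul_cancel₀ hE, mul_one]

end stepG

section stepH
variable {K : Type} [Field K]

theorem DP_sum [Infinite K] {k : ℕ} {x : Fin (k + 1) → K} (hx : Gen x) (C p : ℕ)
    (hp : 2 * p ≤ C) :
    DP x C p = EE x * Vp x * ∑ ν ∈ ((Fintype.piFinset fun _ : Fin (k + 1) =>
        Finset.range (C + 1)).filter (fun ν => Antitone ν)),
          (bCoeff (k + 1) C p ν : K) * schur (fun i => (ν i : ℤ)) x := by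
  have hinj : Function.Injective x := fun i j h => by
    by_contra hne
    exact hx.inj i j hne h
  apply mul_right_cancel₀ (Vd_ne hx)
  rw [comb_coeff hx C p (by omega), mul_assoc (EE x * Vp x), Finset.sum_mul]
  congr 1
  symm
  refine Finset.sum_bij' (fun ν _ => fun i => ν i + (k - (i : ℕ)))
    (fun μ _ => fun i => μ i - (k - (i : ℕ))) ?_ ?_ ?_ ?_ ?_
  · intro ν hν
    simp only [Finset.mem_filter, Fintype.mem_piFinset, Finset.mem_range] at hν
    rw [mem_SC]
    refine ⟨fun i => ?_, ?_⟩
    · have := hν.1 i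
      omega
    · intro a b hab
      have := hν.2 hab.le
      have h2 := b.2
      have h3 : (a : ℕ) < b := hab
      simp only
      omega
  · intro μ hμ
    rw [mem_SC] at hμ
    obtain ⟨h1, h2⟩ := hμ
    have hst : ∀ a b : Fin (k + 1), a ≤ b → μ b + ((b : ℕ) - a) ≤ μ a := by
      intro a b hab
      have key : ∀ m : ℕ, ∀ h : (a : ℕ) + m < k + 1, μ ⟨a + m, h⟩ + m ≤ μ a := by
        intro m
        induction m with
        | zero => intro h; simp
        | succ m ih =>
          intro h
          have e1 := ih (by omega)
          have e2 : μ ⟨a + (m + 1), h⟩ < μ ⟨a + m, by omega⟩ := h2 (by simp [Fin.lt_def])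
          omega
      have h3 : (a : ℕ) ≤ b := hab
      have h4 := key ((b : ℕ) - a) (by omega)
      have h5 : (⟨a + ((b : ℕ) - a), by omega⟩ : Fin (k + 1)) = b := Fin.ext (by simp; omega)
      rwa [h5] at h4
    simp only [Finset.mem_filter, Fintype.mem_piFinset, Finset.mem_range]
    refine ⟨fun i => ?_, ?_⟩
    · have e1 := hst 0 i (Fin.zero_le i)
      have e2 := h1 0
      have e3 := i.2
      simp at e1
      omega
    · intro a b hab
      have e1 := hst a b hab
      have e2 : (a : ℕ) ≤ b := hab
      have e3 := hst b (Fin.last k) (Fin.le_last b)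
      have e4 := b.2
      simp only [Fin.val_last] at e3
      simp only
      omega
  · intro ν _
    funext i
    simp
  · intro μ hμ
    rw [mem_SC] at hμ
    funext i
    simp only
    have key : ∀ m : ℕ, m ≤ k → m ≤ μ ⟨k - m, by omega⟩ := by
      intro m
      induction m with
      | zero => intro h; simp
      | succ m ih =>
        intro h
        have e1 := ih (by omega)
        have e2 : μ ⟨k - m, by omega⟩ < μ ⟨k - (m + 1), by omega⟩ :=
          hμ.2 (by simp [Fin.lt_def]; omega)
        omega
    have e1 := key (k - i) (by omega)
    have h5 : (⟨k - (k - (i : ℕ)), by omega⟩ : Fin (k + 1)) = i :=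
      Fin.ext (by have := i.2; simp; omega)
    rw [h5] at e1
    omega
  · intro ν hν
    simp only [Finset.mem_filter, Fintype.mem_piFinset, Finset.mem_range] at hν
    rw [← bCoeff_eq_HP C p hp hν.2 (fun i => Nat.lt_succ_iff.mp (hν.1 i)), mul_assoc,
      schur_alt hinj]
    simp

theorem schur_zero {N k : ℕ} (x : Fin N → K) :
    schur (fun _ : Fin k => (0 : ℤ)) x = 1 := by
  unfold schur
  rw [Matrix.det_of_isUpperTriangular]
  · apply Finset.prod_eq_one
    intro i _
    simp only [Matrix.of_apply]
    rw [show (0 : ℤ) - ((i : ℕ) : ℤ) + ((i : ℕ) : ℤ) = ((0 : ℕ) : ℤ) by simp, hpoly_nat, hn_zero]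
  · intro i j hij
    have : (j : ℕ) < i := hij
    simp only [Matrix.of_apply]
    exact hpoly_neg _ _ (by omega)

theorem DP_zero [Infinite K] {k : ℕ} {x : Fin (k + 1) → K} (hx : Gen x) :
    DP x 0 0 = EE x * Vp x := by
  rw [DP_sum hx 0 0 le_rfl]
  have hs : ((Fintype.piFinset fun _ : Fin (k + 1) =>
        Finset.range (0 + 1)).filter (fun ν => Antitone ν)) = {fun _ => 0} := by
    ext ν
    simp only [Finset.mem_filter, Fintype.mem_piFinset, Finset.mem_range, Finset.mem_singleton]
    constructor
    · intro h
      funext i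
      have := h.1 i
      omega
    · rintro rfl
      exact ⟨fun _ => by simp, fun _ _ _ => le_rfl⟩
  rw [hs, Finset.sum_singleton]
  have hb : bCoeff (k + 1) 0 0 (fun _ => 0) = 1 := by
    unfold bCoeff
    rw [Finset.card_eq_one]
    refine ⟨fun _ => 0, ?_⟩
    ext ν
    simp only [Finset.mem_filter, Fintype.mem_piFinset, Finset.mem_range, Finset.mem_singleton]
    constructor
    · intro h
      funext i
      have := h.1 i
      omega
    · rintro rfl
      exact ⟨fun _ => by simp, fun _ _ _ => le_rfl, fun _ => le_rfl, fun _ _ _ => le_rfl, by simp,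
        fun i j h1 h2 => by omega⟩
  rw [hb]
  have := schur_zero (k := k + 1) x
  simp [this]

theorem num_eq {k : ℕ} (C p : ℕ) (hp : 2 * p ≤ C) {y : Fin (k + 1) → K} (hy : ∀ j, y j ≠ 0) :
    (∏ j, y j) ^ (C + 2 * k + 1) * Matrix.det (Matrix.of fun i j : Fin (k + 1) =>
      y j ^ ((if (i : ℕ) < k + 1 - 1 then (C : ℤ) else (C : ℤ) - 2 * p) +
          2 * ((k + 1 : ℕ) : ℤ) - 2 * ((i : ℕ) : ℤ) - 1) -
        y j ^ (-((if (i : ℕ) < k + 1 - 1 then (C : ℤ) else (C : ℤ) - 2 * p) +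
          2 * ((k + 1 : ℕ) : ℤ) - 2 * ((i : ℕ) : ℤ) - 1))) =
    (-1) ^ (k + 1) * DP (fun j => y j ^ 2) C p := by
  rw [← Finset.prod_pow, ← Matrix.det_mul_row]
  have h1 : (-1 : K) ^ (k + 1) = (-1 : K) ^ Fintype.card (Fin (k + 1)) := by simp
  rw [h1]
  unfold DP
  rw [← Matrix.det_neg]
  congr 1
  ext i j
  simp only [Matrix.of_apply, Matrix.neg_apply]
  have hz : ∀ a b c : ℕ, ∀ e : ℤ, (a : ℤ) + e = b → (a : ℤ) - e = c →
      y j ^ a * (y j ^ e - y j ^ (-e)) = y j ^ b - y j ^ c := by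
    intro a b c e hb hc
    rw [mul_sub, ← zpow_natCast, ← zpow_add₀ (hy j), ← zpow_add₀ (hy j), hb, ← sub_eq_add_neg, hc,
      zpow_natCast, zpow_natCast]
  by_cases hi : i = Fin.last k
  · subst hi
    rw [Matrix.updateRow_self]
    simp only [Fin.val_last]
    rw [if_neg (by omega), hz _ (2 * (C + 2 * k + 1 - (k + p))) (2 * (k + p)) _
      (by push_cast; omega) (by push_cast; omega)]
    simp only [phi, pow_mul]
    ring
  · have hlt : (i : ℕ) < k := by
      have h2 := i.2
      have h3 : (i : ℕ) ≠ k := fun h => hi (Fin.ext h)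
      omega
    rw [Matrix.updateRow_ne hi]
    rw [if_pos (by omega), hz _ (2 * (C + 2 * k + 1 - i)) (2 * i) _
      (by push_cast; omega) (by push_cast; omega)]
    simp only [phi, pow_mul, Matrix.of_apply]
    ring

theorem soOdd_main [Infinite K] {k : ℕ} (C p : ℕ) (hp : 2 * p ≤ C) {y : Fin (k + 1) → K}
    (hy : ∀ j, y j ≠ 0) (hx : Gen (fun j => y j ^ 2)) :
    soOdd (k + 1) (fun i : Fin (k + 1) =>
        if (i : ℕ) < k + 1 - 1 then (C : ℤ) else (C : ℤ) - 2 * p) y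
      = (∏ i, y i) ^ (-(C : ℤ)) *
        ∑ ν ∈ ((Fintype.piFinset fun _ : Fin (k + 1) => Finset.range (C + 1)).filter
          (fun ν => Antitone ν)),
          (bCoeff (k + 1) C p ν : K) * schur (fun i => (ν i : ℤ)) (fun j => y j ^ 2) := by
  have hY : (∏ j, y j) ≠ 0 := Finset.prod_ne_zero_iff.mpr fun j _ => hy j
  have e1 := num_eq C p hp hy
  have e2 := num_eq 0 0 le_rfl hy
  rw [DP_sum hx C p hp] at e1
  rw [DP_zero hx] at e2
  have hE : EE (fun j => y j ^ 2) * Vp (fun j => y j ^ 2) ≠ 0 :=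
    mul_ne_zero (EE_ne hx) (Vp_ne hx)
  have hden : (Matrix.of fun i j : Fin (k + 1) =>
      y j ^ (2 * ((k + 1 : ℕ) : ℤ) - 2 * ((i : ℕ) : ℤ) - 1) -
        y j ^ (-(2 * ((k + 1 : ℕ) : ℤ) - 2 * ((i : ℕ) : ℤ) - 1))) =
      (Matrix.of fun i j : Fin (k + 1) =>
      y j ^ ((if (i : ℕ) < k + 1 - 1 then ((0 : ℕ) : ℤ) else ((0 : ℕ) : ℤ) - 2 * (0 : ℕ)) +
          2 * ((k + 1 : ℕ) : ℤ) - 2 * ((i : ℕ) : ℤ) - 1) -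
        y j ^ (-((if (i : ℕ) < k + 1 - 1 then ((0 : ℕ) : ℤ) else ((0 : ℕ) : ℤ) - 2 * (0 : ℕ)) +
          2 * ((k + 1 : ℕ) : ℤ) - 2 * ((i : ℕ) : ℤ) - 1))) := by
    ext i j
    simp
  unfold soOdd
  rw [hden]
  set A := Matrix.det (Matrix.of fun i j : Fin (k + 1) =>
      y j ^ ((if (i : ℕ) < k + 1 - 1 then (C : ℤ) else (C : ℤ) - 2 * p) +
          2 * ((k + 1 : ℕ) : ℤ) - 2 * ((i : ℕ) : ℤ) - 1) -
        y j ^ (-((if (i : ℕ) < k + 1 - 1 then (C : ℤ) else (C : ℤ) - 2 * p) +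
          2 * ((k + 1 : ℕ) : ℤ) - 2 * ((i : ℕ) : ℤ) - 1))) with hA
  set B := Matrix.det (Matrix.of fun i j : Fin (k + 1) =>
      y j ^ ((if (i : ℕ) < k + 1 - 1 then ((0 : ℕ) : ℤ) else ((0 : ℕ) : ℤ) - 2 * (0 : ℕ)) +
          2 * ((k + 1 : ℕ) : ℤ) - 2 * ((i : ℕ) : ℤ) - 1) -
        y j ^ (-((if (i : ℕ) < k + 1 - 1 then ((0 : ℕ) : ℤ) else ((0 : ℕ) : ℤ) - 2 * (0 : ℕ)) +
          2 * ((k + 1 : ℕ) : ℤ) - 2 * ((i : ℕ) : ℤ) - 1))) with hB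
  generalize (∑ ν ∈ ((Fintype.piFinset fun _ : Fin (k + 1) => Finset.range (C + 1)).filter
          (fun ν => Antitone ν)),
          (bCoeff (k + 1) C p ν : K) * schur (fun i => (ν i : ℤ)) (fun j => y j ^ 2)) = S at e1 ⊢
  have hs : (-1 : K) ^ (k + 1) ≠ 0 := pow_ne_zero _ (neg_ne_zero.mpr one_ne_zero)
  have hB0 : B ≠ 0 := by
    intro h
    rw [h, mul_zero] at e2
    exact mul_ne_zero hs hE e2.symm
  rw [div_eq_iff hB0, zpow_neg, zpow_natCast, mul_assoc, eq_inv_mul_iff_mul_eq₀ (pow_ne_zero _ hY)]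
  apply mul_left_cancel₀ (pow_ne_zero (2 * k + 1) hY)
  have e3 : (∏ j, y j) ^ (2 * k + 1) * ((∏ j, y j) ^ C * A) =
      (∏ j, y j) ^ (C + 2 * k + 1) * A := by ring
  have e4 : (∏ j, y j) ^ (2 * k + 1) * (S * B) =
      S * ((∏ j, y j) ^ (0 + 2 * k + 1) * B) := by
    rw [zero_add]; ring
  rw [e3, e4, e1, e2]
  ring

theorem Xv_inj (n : ℕ) : Function.Injective
    (algebraMap (MvPolynomial (Fin n) ℚ) (FF n)) := IsFractionRing.injective _ _

theorem Xv_ne (n : ℕ) (j : Fin n) : Xv n j ≠ 0 := by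
  unfold Xv
  rw [Ne, map_eq_zero_iff _ (Xv_inj n)]
  exact MvPolynomial.X_ne_zero j

theorem Xv_gen (n : ℕ) : Gen (fun j => Xv n j ^ 2) := by
  have key : ∀ P Q : MvPolynomial (Fin n) ℚ, (∃ v : Fin n → ℚ, MvPolynomial.eval v P ≠
      MvPolynomial.eval v Q) → algebraMap _ (FF n) P ≠ algebraMap _ (FF n) Q := by
    rintro P Q ⟨v, hv⟩ h
    exact hv (by rw [Xv_inj n h])
  refine ⟨?_, ?_, ?_, ?_⟩
  · intro i j hij
    have := key (MvPolynomial.X i ^ 2) (MvPolynomial.X j ^ 2)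
      ⟨fun l => if l = i then 1 else 0, by simp [hij.symm]⟩
    simpa only [Xv, map_pow] using this
  · intro i
    have := key (MvPolynomial.X i ^ 2) 1 ⟨fun l => 0, by simp⟩
    simpa only [Xv, map_pow, map_one] using this
  · intro i
    have := key (MvPolynomial.X i ^ 2) (-1) ⟨fun l => 0, by simp⟩
    simpa only [Xv, map_pow, map_one, map_neg] using this
  · intro i j hij
    have := key (MvPolynomial.X i ^ 2 * MvPolynomial.X j ^ 2) 1 ⟨fun l => 0, by simp⟩
    simpa only [Xv, map_pow, map_one, map_mul] using this

theorem FF_inf (n : ℕ) : Infinite (FF n) := by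
  have : Function.Injective (fun q : ℚ => algebraMap (MvPolynomial (Fin n) ℚ) (FF n)
      (MvPolynomial.C q)) := (Xv_inj n).comp (MvPolynomial.C_injective _ _)
  exact Infinite.of_injective _ this

end stepH
/-- `so_{2n+1}((c^{n-1}, c-p); x^{±1}) = (x_1⋯x_n)^{-c} ·
∑_{ν ⊆ ((2c)^n)} b_{n,p}(ν) s_n(ν; x)`; stated in the variables `y` with
`x_j = y_j²`, where `C = 2c`. -/
theorem soOdd_nearly_rectangular_cols_eq_sum_schur
    (n C p : ℕ) (hn : 1 ≤ n) (hp : 2 * p ≤ C) :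
    soOdd n (fun i : Fin n => if (i : ℕ) < n - 1 then (C : ℤ) else (C : ℤ) - 2 * p) (Xv n)
      = (∏ i : Fin n, Xv n i) ^ (-(C : ℤ)) *
        ∑ ν ∈ ((Fintype.piFinset fun _ : Fin n => Finset.range (C + 1)).filter
          (fun ν => Antitone ν)),
          (bCoeff n C p ν : FF n) * schur (fun i => (ν i : ℤ)) (fun j => Xv n j ^ 2) := by
  obtain ⟨k, rfl⟩ : ∃ k, n = k + 1 := ⟨n - 1, by omega⟩
  have := FF_inf (k + 1)
  exact soOdd_main C p hp (Xv_ne (k + 1)) (Xv_gen (k + 1))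

end
end

section
/- Let n, c, d, p be nonnegative integers with p ≤ n and c ≤ d. Then, as an identity of rational functions in x_1,…,x_n, sp_{2n}((c^n); x^{±1}) · sp_{2n}(((d+1)^p, d^{n−p}); x^{±1}) = Σ_ν sp_{2n}(ν; x^{±1}), where ν ranges over all partitions with ((d−c)^n) ⊆ ν ⊆ ((c+d+1)^n) such that exactly p of the numbers ν_1−(d−c), …, ν_n−(d−c) are odd. -/
open scoped Classical
open Finset

noncomputable section

/-- Irreducible symplectic character `sp_{2n}(λ; x^{±1})` via the Weyl character formula. -/
def spWeyl {F : Type} [Field F] (n : ℕ) (lam : Fin n → ℤ) (x : Fin n → F) : F :=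
  Matrix.det (Matrix.of fun i j : Fin n =>
    x j ^ (lam i + (n : ℤ) - ((i : ℕ) : ℤ)) - x j ^ (-(lam i + (n : ℤ) - ((i : ℕ) : ℤ)))) /
  Matrix.det (Matrix.of fun i j : Fin n =>
    x j ^ ((n : ℤ) - ((i : ℕ) : ℤ)) - x j ^ (-((n : ℤ) - ((i : ℕ) : ℤ))))



/-! ### Alternants -/

/-- The alternant `det (u_j ^ l_i)`. -/
def altn {F : Type} [Field F] {n : ℕ} (l : Fin n → ℤ) (u : Fin n → F) : F :=
  Matrix.det (Matrix.of fun i j : Fin n => u j ^ l i)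

/-- The staircase `(n-1, ..., 1, 0)`. -/
def stair (n : ℕ) : Fin n → ℤ := fun i => (n : ℤ) - 1 - ((i : ℕ) : ℤ)

/-- The Vandermonde product. -/
def vand {F : Type} [Field F] {n : ℕ} (u : Fin n → F) : F :=
  ∏ i : Fin n, ∏ j ∈ Finset.Ioi i, (u i - u j)

theorem altn_stair {F : Type} [Field F] {n : ℕ} (u : Fin n → F) :
    altn (stair n) u = vand u := by
  have h := Matrix.det_projVandermonde (fun _ : Fin n => (1 : F)) u
  unfold vand altn
  rw [← Matrix.det_transpose]
  simp only [one_mul] at h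
  rw [← h]
  congr 1
  ext i j
  simp only [Matrix.transpose_apply, Matrix.of_apply, Matrix.projVandermonde_apply, one_pow,
    one_mul, stair]
  rw [← zpow_natCast]
  congr 1
  rw [Fin.val_rev]
  have := j.2
  omega

theorem altn_perm {F : Type} [Field F] {n : ℕ} (l : Fin n → ℤ) (u : Fin n → F)
    (σ : Equiv.Perm (Fin n)) :
    altn l (u ∘ σ) = ((Equiv.Perm.sign σ : ℤ) : F) * altn l u := by
  unfold altn
  rw [← Matrix.det_permute']
  rfl

theorem vand_cons {F : Type} [Field F] {n : ℕ} (a : F) (u : Fin n → F) :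
    vand (Fin.cons a u : Fin (n + 1) → F) = (∏ k, (a - u k)) * vand u := by
  unfold vand
  rw [Fin.prod_univ_succ]
  simp [Fin.prod_Ioi_zero, Fin.prod_Ioi_succ]

theorem vand_succAbove {F : Type} [Field F] {n : ℕ} (u : Fin (n + 1) → F) (j : Fin (n + 1)) :
    vand u = (-1) ^ (j : ℕ) * (∏ k, (u j - u (j.succAbove k))) * vand (fun k => u (j.succAbove k))
    := by
  have h1 : (Fin.cons (u j) (fun k => u (j.succAbove k)) : Fin (n + 1) → F)
      = u ∘ j.cycleRange.symm := by
    funext i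
    refine Fin.cases ?_ (fun k => ?_) i
    · simp
    · simp
  have h2 := vand_cons (u j) (fun k => u (j.succAbove k))
  rw [h1, ← altn_stair, altn_perm, altn_stair] at h2
  rw [mul_assoc, ← h2]
  rw [Equiv.Perm.sign_symm, Fin.sign_cycleRange]
  push_cast
  rw [← mul_assoc, ← mul_pow]
  simp

theorem vand_ne_zero {F : Type} [Field F] {n : ℕ} (u : Fin n → F) (hu : Function.Injective u) :
    vand u ≠ 0 := by
  unfold vand
  refine Finset.prod_ne_zero_iff.mpr fun i _ => Finset.prod_ne_zero_iff.mpr fun j hj => ?_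
  rw [Finset.mem_Ioi] at hj
  rw [sub_ne_zero]
  exact fun h => hj.ne (hu h)

theorem altn_add_const {F : Type} [Field F] {n : ℕ} (l : Fin n → ℤ) (u : Fin n → F)
    (hu : ∀ i, u i ≠ 0) (a : ℤ) :
    altn (fun i => l i + a) u = (∏ j, u j ^ a) * altn l u := by
  unfold altn
  rw [← Matrix.det_mul_row]
  congr 1
  ext i j
  simp only [Matrix.of_apply]
  rw [zpow_add₀ (hu j), mul_comm]

/-! ### Lagrange interpolation identity -/

theorem prod_erase_succAbove {F : Type} [Field F] {n : ℕ} (i : Fin (n + 1)) (f : Fin (n + 1) → F) :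
    ∏ j ∈ Finset.univ.erase i, f j = ∏ k, f (i.succAbove k) := by
  have : (Finset.univ.erase i) = Finset.univ.image i.succAbove := by
    ext j
    simp [Fin.exists_succAbove_eq_iff]
  rw [this, Finset.prod_image]
  intro a _ b _ h
  exact Fin.succAbove_right_injective h

theorem lagrange_id {F : Type} [Field F] {n : ℕ} (y z : Fin (n + 1) → F)
    (hy : Function.Injective y) (hy0 : ∀ i, y i ≠ 0) :
    ∑ j, (∏ i, (y j - z i)) / (y j * ∏ k, (y j - y (j.succAbove k))) = 1 - ∏ i, (z i / y i) := by
  let P : Polynomial F := ∏ i, (Polynomial.X - Polynomial.C (z i))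
  have hPm : P.Monic := Polynomial.monic_prod_of_monic _ _ fun i _ => Polynomial.monic_X_sub_C _
  have hdeg : P.natDegree = n + 1 := by
    have := Polynomial.natDegree_prod_of_monic Finset.univ
      (fun i : Fin (n + 1) => Polynomial.X - Polynomial.C (z i))
      (fun i _ => Polynomial.monic_X_sub_C _)
    rw [this]
    simp
  have hinj : Function.Injective (Fin.cons 0 y : Fin (n + 2) → F) := by
    rw [Fin.cons_injective_iff]
    refine ⟨?_, hy⟩
    rintro ⟨i, hi⟩
    exact hy0 i hi
  have key := Lagrange.leadingCoeff_eq_sum (s := Finset.univ)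
    (v := (Fin.cons 0 y : Fin (n + 2) → F)) (P := P) hinj.injOn (by
      rw [Polynomial.degree_eq_natDegree hPm.ne_zero, hdeg]
      simp)
  rw [hPm.leadingCoeff, Fin.sum_univ_succ] at key
  simp only [prod_erase_succAbove] at key
  have hev : ∀ t, P.eval t = ∏ i, (t - z i) := by
    intro t
    simp [P, Polynomial.eval_prod]
  simp only [hev, Fin.cons_zero, Fin.cons_succ, Fin.zero_succAbove, Fin.prod_univ_succ
    (fun k : Fin (n + 1) => (_ : F) - (Fin.cons 0 y : Fin (n + 2) → F) _),
    Fin.succ_succAbove_zero, Fin.succ_succAbove_succ, sub_zero] at key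
  rw [key]
  rw [← Finset.prod_div_distrib]
  have : ∏ x, (0 - z x) / (0 - y x) = ∏ i, z i / y i := by
    refine Finset.prod_congr rfl fun i _ => ?_
    rw [zero_sub, zero_sub, neg_div_neg_eq]
  rw [this]
  ring

/-! ### Sign flips -/

/-- `true ↦ 1`, `false ↦ -1`. -/
def bsgn (b : Bool) : ℤ := if b then 1 else -1

/-- Product of the signs. -/
def esgn {F : Type} [Field F] {n : ℕ} (e : Fin n → Bool) : F := ∏ j, ((bsgn (e j) : ℤ) : F)

/-- Invert the variables where `e` is false. -/
def flipv {F : Type} [Field F] {n : ℕ} (e : Fin n → Bool) (u : Fin n → F) : Fin n → F :=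
  fun j => u j ^ bsgn (e j)

/-- Generic tuples. -/
structure Gen_s9 {F : Type} [Field F] {n : ℕ} (u : Fin n → F) : Prop where
  ne_zero : ∀ i, u i ≠ 0
  inj : Function.Injective u
  mul_ne : ∀ i j, u i * u j ≠ 1

theorem Gen_s9.succAbove {F : Type} [Field F] {n : ℕ} {u : Fin (n + 1) → F} (hu : Gen_s9 u)
    (j : Fin (n + 1)) : Gen_s9 (fun k => u (j.succAbove k)) :=
  ⟨fun i => hu.ne_zero _, fun _ _ h => Fin.succAbove_right_injective (hu.inj h),
    fun _ _ => hu.mul_ne _ _⟩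

theorem flipv_cases {F : Type} [Field F] {n : ℕ} (e : Fin n → Bool) (u : Fin n → F) (j : Fin n) :
    (e j = true ∧ flipv e u j = u j) ∨ (e j = false ∧ flipv e u j = (u j)⁻¹) := by
  unfold flipv bsgn
  cases e j <;> simp

theorem Gen_s9.flipv {F : Type} [Field F] {n : ℕ} {u : Fin n → F} (hu : Gen_s9 u)
    (e : Fin n → Bool) : Gen_s9 (flipv e u) := by
  have h0 := hu.ne_zero
  refine ⟨fun i => ?_, fun i j h => ?_, fun i j h => ?_⟩
  · exact zpow_ne_zero _ (h0 i)
  · rcases flipv_cases e u i with ⟨_, hi⟩ | ⟨_, hi⟩ <;>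
      rcases flipv_cases e u j with ⟨_, hj⟩ | ⟨_, hj⟩ <;> rw [hi, hj] at h
    · exact hu.inj h
    · exact absurd (by rw [h, inv_mul_cancel₀ (h0 j)]) (hu.mul_ne i j)
    · exact absurd (by rw [← h, mul_inv_cancel₀ (h0 i)]) (hu.mul_ne i j)
    · exact hu.inj (inv_injective h)
  · rcases flipv_cases e u i with ⟨ei, hi⟩ | ⟨ei, hi⟩ <;>
      rcases flipv_cases e u j with ⟨ej, hj⟩ | ⟨ej, hj⟩ <;> rw [hi, hj] at h
    · exact hu.mul_ne i j h
    · rw [mul_inv_eq_one₀ (h0 j)] at h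
      have := hu.inj h
      subst this
      simp [ei] at ej
    · rw [inv_mul_eq_one₀ (h0 i)] at h
      have := hu.inj h
      subst this
      simp [ei] at ej
    · rw [← mul_inv, inv_eq_one] at h
      exact hu.mul_ne i j h

/-- Symplectic numerator determinant. -/
def spdet {F : Type} [Field F] {n : ℕ} (l : Fin n → ℤ) (u : Fin n → F) : F :=
  Matrix.det (Matrix.of fun i j : Fin n => u j ^ l i - u j ^ (-l i))

theorem spdet_eq_sum {F : Type} [Field F] {n : ℕ} (l : Fin n → ℤ) (u : Fin n → F) :
    spdet l u = ∑ e : Fin n → Bool, esgn e * altn l (flipv e u) := by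
  unfold spdet altn
  simp only [Matrix.det_apply', Finset.mul_sum]
  rw [Finset.sum_comm]
  refine Finset.sum_congr rfl fun σ _ => ?_
  have h : ∀ e : Fin n → Bool, (esgn e : F) * (((Equiv.Perm.sign σ : ℤ) : F) *
      ∏ i, (Matrix.of fun i j : Fin n => flipv e u j ^ l i) (σ i) i) =
      ((Equiv.Perm.sign σ : ℤ) : F) *
        ∏ i, (((bsgn (e i) : ℤ) : F) * u i ^ (bsgn (e i) * l (σ i))) := by
    intro e
    rw [Finset.prod_mul_distrib]
    simp only [esgn, flipv, Matrix.of_apply, zpow_mul]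
    ring
  simp only [h]
  rw [← Finset.mul_sum]
  congr 1
  have h2 := Finset.prod_univ_sum (fun _ : Fin n => (Finset.univ : Finset Bool))
    (fun i b => (((bsgn b : ℤ) : F) * u i ^ (bsgn b * l (σ i))))
  rw [Fintype.piFinset_univ] at h2
  rw [← h2]
  refine Finset.prod_congr rfl fun i _ => ?_
  simp [bsgn, sub_eq_add_neg]

theorem esgn_mul_self {F : Type} [Field F] {n : ℕ} (e : Fin n → Bool) :
    (esgn e : F) * esgn e = 1 := by
  unfold esgn
  rw [← Finset.prod_mul_distrib]
  refine Finset.prod_eq_one fun i _ => ?_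
  unfold bsgn
  cases e i <;> simp

theorem spdet_flipv {F : Type} [Field F] {n : ℕ} (l : Fin n → ℤ) (u : Fin n → F)
    (e : Fin n → Bool) : spdet l (flipv e u) = esgn e * spdet l u := by
  unfold spdet esgn
  rw [← Matrix.det_mul_row]
  congr 1
  ext i j
  simp only [Matrix.of_apply]
  rcases flipv_cases e u j with ⟨h, h'⟩ | ⟨h, h'⟩ <;> simp [h, h', bsgn]

/-- The product form of the Weyl denominator. -/
def weylDen {F : Type} [Field F] {n : ℕ} (u : Fin n → F) : F :=
  vand (fun i => u i + (u i)⁻¹) * ∏ i, (u i - (u i)⁻¹)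

theorem Gen_s9.weylDen_ne {F : Type} [Field F] {n : ℕ} {u : Fin n → F} (hu : Gen_s9 u) :
    weylDen u ≠ 0 := by
  have h0 := hu.ne_zero
  refine mul_ne_zero (vand_ne_zero _ fun i j h => ?_) (Finset.prod_ne_zero_iff.mpr fun i _ h => ?_)
  · replace h : u i + (u i)⁻¹ = u j + (u j)⁻¹ := h
    have h1 : (u i - u j) * (u i * u j - 1) = 0 := by
      have hi := h0 i
      have hj := h0 j
      field_simp at h
      linear_combination h
    rcases mul_eq_zero.mp h1 with h2 | h2
    · exact hu.inj (sub_eq_zero.mp h2)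
    · exact absurd (sub_eq_zero.mp h2) (hu.mul_ne i j)
  · have hi := h0 i
    field_simp at h
    exact hu.mul_ne i i (by linear_combination h)

theorem weylDen_succAbove {F : Type} [Field F] {n : ℕ} {u : Fin (n + 1) → F} (hu : Gen_s9 u)
    (j : Fin (n + 1)) :
    weylDen u * vand (fun k => u (j.succAbove k)) = vand u *
      ((u j - (u j)⁻¹) * ∏ k, (1 - (u j * u (j.succAbove k))⁻¹)) *
      weylDen (fun k => u (j.succAbove k)) := by
  unfold weylDen
  rw [vand_succAbove u j, vand_succAbove _ j, Fin.prod_univ_succAbove _ j]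
  have : ∏ k, (u j + (u j)⁻¹ - (u (j.succAbove k) + (u (j.succAbove k))⁻¹)) =
      (∏ k, (u j - u (j.succAbove k))) * ∏ k, (1 - (u j * u (j.succAbove k))⁻¹) := by
    rw [← Finset.prod_mul_distrib]
    refine Finset.prod_congr rfl fun k _ => ?_
    have h1 := hu.ne_zero j
    have h2 := hu.ne_zero (j.succAbove k)
    field_simp
    ring
  rw [this]
  ring

/-! ### The recurrence -/

/-- The rectangular sum. -/
def hsum {F : Type} [Field F] {n : ℕ} (C : ℤ) (u : Fin n → F) : F :=
  ∑ e : Fin n → Bool, esgn e * (∏ i, (flipv e u i ^ C * u i ^ (C - 1))) * vand (flipv e u)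

theorem sum_bool_succAbove {F : Type} [Field F] {n : ℕ} (j : Fin (n + 1))
    (f : (Fin n → Bool) → F) :
    ∑ e, f e = ∑ e : Fin (n + 1) → Bool, if e j then f (fun k => e (j.succAbove k)) else 0 := by
  rw [← (Fin.insertNthEquiv (fun _ => Bool) j).sum_comp]
  rw [Fintype.sum_prod_type]
  simp [Fin.insertNthEquiv]

theorem hsum_step {F : Type} [Field F] {n : ℕ} {u : Fin (n + 1) → F} (hu : Gen_s9 u) (C : ℤ) :
    hsum (C + 1) u - hsum C u = ∑ j : Fin (n + 1), (-1) ^ (j : ℕ) * u j ^ (2 * C + n) *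
      ((u j - (u j)⁻¹) * ∏ k, (1 - (u j * u (j.succAbove k))⁻¹)) *
      hsum (C + 1) (fun k => u (j.succAbove k)) := by
  have h0 := hu.ne_zero
  unfold hsum
  rw [← Finset.sum_sub_distrib]
  have : ∀ j : Fin (n + 1), _ := fun j => sum_bool_succAbove j (fun e : Fin n → Bool => esgn e *
    (∏ i, (flipv e (fun k => u (j.succAbove k)) i ^ (C + 1) * u (j.succAbove i) ^ (C + 1 - 1))) *
      vand (flipv e (fun k => u (j.succAbove k))))
  simp only [this, Finset.mul_sum]
  rw [Finset.sum_comm]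
  refine Finset.sum_congr rfl fun e _ => ?_
  have hv := hu.flipv e
  have hv0 := hv.ne_zero
  have hL := lagrange_id (flipv e u) (fun i => (u i)⁻¹) hv.inj hv0
  have e1 : ∏ i, (flipv e u i ^ C * u i ^ (C - 1)) =
      (∏ i, (flipv e u i ^ (C + 1) * u i ^ (C + 1 - 1))) * ∏ i, ((u i)⁻¹ / flipv e u i) := by
    rw [← Finset.prod_mul_distrib]
    refine Finset.prod_congr rfl fun i _ => ?_
    rw [zpow_add_one₀ (hv0 i), add_sub_cancel_right, zpow_sub_one₀ (h0 i)]
    have := hv0 i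
    field_simp
  rw [e1]
  have e2 : ∀ a b c d : F, a * b * c - a * (b * d) * c = a * b * c * (1 - d) := by
    intros; ring
  rw [e2, ← hL, Finset.mul_sum]
  refine Finset.sum_congr rfl fun j _ => ?_
  rcases flipv_cases e u j with ⟨he, hj⟩ | ⟨he, hj⟩
  · rw [if_pos he, vand_succAbove (flipv e u) j, Fin.prod_univ_succAbove _ j,
      Fin.prod_univ_succAbove _ j]
    have e3 : (esgn e : F) = esgn (fun k => e (j.succAbove k)) := by
      unfold esgn
      rw [Fin.prod_univ_succAbove _ j, he]
      simp [bsgn]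
    have e4 : ∏ k, (u j - (u (j.succAbove k))⁻¹) =
        u j ^ n * ∏ k, (1 - (u j * u (j.succAbove k))⁻¹) := by
      have : u j ^ n = ∏ k : Fin n, u j := by simp
      rw [this, ← Finset.prod_mul_distrib]
      refine Finset.prod_congr rfl fun k _ => ?_
      have h1 := h0 j
      have h2 := h0 (j.succAbove k)
      field_simp
    have e5 : ∏ k, (u j - flipv e u (j.succAbove k)) ≠ 0 := by
      refine Finset.prod_ne_zero_iff.mpr fun k _ h => ?_
      rw [← hj, sub_eq_zero] at h
      exact Fin.succAbove_ne j k (hv.inj h).symm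
    have e6 : flipv (fun k => e (j.succAbove k)) (fun k => u (j.succAbove k)) =
        fun k => flipv e u (j.succAbove k) := rfl
    rw [e6, e3, hj, e4]
    have e7 : u j ^ (2 * C + n) = u j ^ C * u j ^ C * u j ^ n := by
      rw [zpow_add₀ (h0 j), two_mul, zpow_add₀ (h0 j), zpow_natCast]
    rw [e7, zpow_add_one₀ (h0 j), add_sub_cancel_right]
    have := h0 j
    generalize ∏ k, (u j - flipv e u (j.succAbove k)) = X at *
    field_simp
  · rw [if_neg (by simp [he])]
    have : ∏ i, (flipv e u j - (u i)⁻¹) = 0 := by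
      refine Finset.prod_eq_zero (Finset.mem_univ j) ?_
      rw [hj, sub_self]
    rw [this]
    simp

theorem hsum_eq {F : Type} [Field F] {n : ℕ} {u : Fin n → F} (hu : Gen_s9 u) (C : ℤ) :
    hsum C u = (∏ i, u i ^ (C - 1)) * spdet (fun i => stair n i + C) u := by
  rw [spdet_eq_sum, Finset.mul_sum]
  unfold hsum
  refine Finset.sum_congr rfl fun e _ => ?_
  rw [altn_add_const _ _ (hu.flipv e).ne_zero, altn_stair, Finset.prod_mul_distrib]
  ring

theorem hsum_zero {F : Type} [Field F] {n : ℕ} {u : Fin (n + 1) → F} (hu : Gen_s9 u) :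
    hsum 0 u = 0 := by
  rw [hsum_eq hu]
  have : spdet (fun i => stair (n + 1) i + 0) u = 0 := by
    unfold spdet
    refine Matrix.det_eq_zero_of_row_eq_zero (Fin.last n) fun j => ?_
    simp [stair]
  rw [this, mul_zero]

/-- Partitions in a box. -/
def boxp (n C : ℕ) : Finset (Fin n → ℕ) :=
  (Fintype.piFinset fun _ : Fin n => Finset.range C).filter Antitone

theorem mem_boxp {n C : ℕ} {m : Fin n → ℕ} : m ∈ boxp n C ↔ (∀ i, m i < C) ∧ Antitone m := by
  simp [boxp]

/-- Sum of alternants over partitions with even rows. -/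
def gsum {F : Type} [Field F] {n : ℕ} (C : ℕ) (u : Fin n → F) : F :=
  ∑ m ∈ boxp n C, altn (fun i => stair n i + 2 * (m i : ℤ)) u

theorem antitone_cons {n C : ℕ} {m : Fin n → ℕ} (hm : Antitone m) (h : ∀ i, m i ≤ C) :
    Antitone (Fin.cons C m : Fin (n + 1) → ℕ) := by
  intro i j hij
  induction i using Fin.cases with
  | zero =>
    induction j using Fin.cases with
    | zero => simp
    | succ j => simpa using h j
  | succ i =>
    induction j using Fin.cases with
    | zero => simp at hij
    | succ j => simpa using hm (by simpa using hij)

theorem gsum_step {F : Type} [Field F] {n : ℕ} (C : ℕ) (u : Fin (n + 1) → F) :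
    gsum (C + 1) u = gsum C u + ∑ j : Fin (n + 1), (-1) ^ (j : ℕ) * u j ^ (2 * (C : ℤ) + n) *
      gsum (C + 1) (fun k => u (j.succAbove k)) := by
  have h1 : boxp (n + 1) (C + 1) = boxp (n + 1) C ∪
      (boxp n (C + 1)).image (fun m => (Fin.cons C m : Fin (n + 1) → ℕ)) := by
    ext m
    simp only [Finset.mem_union, Finset.mem_image, mem_boxp]
    constructor
    · rintro ⟨hb, ha⟩
      by_cases h : m 0 < C
      · exact Or.inl ⟨fun i => lt_of_le_of_lt (ha (Fin.zero_le i)) h, ha⟩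
      · refine Or.inr ⟨fun i => m i.succ, ⟨fun i => hb _, fun i j hij => ha (by simpa using hij)⟩, ?_⟩
        have : C = m 0 := by
          have := hb 0
          omega
        rw [this]
        exact Fin.cons_self_tail m
    · rintro (⟨hb, ha⟩ | ⟨m', ⟨hb, ha⟩, rfl⟩)
      · exact ⟨fun i => (hb i).trans (Nat.lt_succ_self _), ha⟩
      · refine ⟨fun i => ?_, antitone_cons ha fun i => Nat.lt_succ_iff.mp (hb i)⟩
        refine Fin.cases ?_ (fun k => ?_) i
        · simp
        · simpa using hb k
  have h2 : Disjoint (boxp (n + 1) C)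
      ((boxp n (C + 1)).image (fun m => (Fin.cons C m : Fin (n + 1) → ℕ))) := by
    rw [Finset.disjoint_left]
    intro m hm hm'
    obtain ⟨m', _, rfl⟩ := Finset.mem_image.mp hm'
    have := (mem_boxp.mp hm).1 0
    simp at this
  unfold gsum
  rw [h1, Finset.sum_union h2, Finset.sum_image (by
    intro a _ b _ h
    exact Fin.cons_right_injective (α := fun _ => ℕ) C h)]
  congr 1
  simp only [Finset.mul_sum]
  rw [Finset.sum_comm]
  refine Finset.sum_congr rfl fun m _ => ?_
  unfold altn
  rw [Matrix.det_succ_row_zero]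
  refine Finset.sum_congr rfl fun j _ => ?_
  congr 1
  · simp only [Matrix.of_apply, stair, Fin.cons_zero]
    congr 2
    push_cast
    simp
    ring
  · congr 1
    ext i k
    simp only [Matrix.of_apply, Matrix.submatrix_apply, stair, Fin.cons_succ]
    congr 1
    push_cast
    simp
    ring

theorem main_rect {F : Type} [Field F] : ∀ (n : ℕ) (C : ℕ) (u : Fin n → F), Gen_s9 u →
    weylDen u * gsum C u = vand u * hsum (C : ℤ) u := by
  intro n
  induction n with
  | zero =>
    intro C u _
    have hb : boxp 0 C = {fun i => i.elim0} := by
      ext m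
      simp only [mem_boxp, Finset.mem_singleton]
      exact ⟨fun _ => Subsingleton.elim _ _, fun _ => ⟨fun i => i.elim0, fun i => i.elim0⟩⟩
    simp [weylDen, gsum, hsum, vand, hb, altn, esgn]
  | succ n ih =>
    intro C
    induction C with
    | zero =>
      intro u hu
      have hb : boxp (n + 1) 0 = ∅ := by
        ext m
        simp only [mem_boxp]
        simp
      simp [gsum, hb, hsum_zero hu]
    | succ C ihC =>
      intro u hu
      rw [gsum_step, mul_add, ihC u hu]
      have hs := hsum_step hu (C : ℤ)
      have : ((C + 1 : ℕ) : ℤ) = (C : ℤ) + 1 := by push_cast; rfl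
      rw [this, eq_comm, ← sub_eq_iff_eq_add', ← mul_sub, hs, Finset.mul_sum, Finset.mul_sum]
      refine Finset.sum_congr rfl fun j _ => ?_
      have ihj := ih (C + 1) _ (hu.succAbove j)
      have hw := weylDen_succAbove hu j
      have hne := (hu.succAbove j).weylDen_ne
      rw [this] at ihj
      apply mul_left_cancel₀ hne
      linear_combination (-((-1) ^ (j : ℕ) * u j ^ (2 * (C : ℤ) + n) *
        hsum ((C : ℤ) + 1) (fun k => u (j.succAbove k)))) * hw
        - ((-1) ^ (j : ℕ) * u j ^ (2 * (C : ℤ) + n) * weylDen u) * ihj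

theorem weyl_denom {F : Type} [Field F] {n : ℕ} {u : Fin n → F} (hu : Gen_s9 u) :
    spdet (fun i => stair n i + 1) u = weylDen u := by
  have h := main_rect n 1 u hu
  have hb : boxp n 1 = {0} := by
    ext m
    simp only [mem_boxp, Finset.mem_singleton]
    constructor
    · rintro ⟨h, _⟩
      funext i
      have := h i
      simp only [Pi.zero_apply]
      omega
    · rintro rfl
      exact ⟨fun i => by simp, antitone_const⟩
  have hg : gsum 1 u = vand u := by
    rw [← altn_stair]
    simp [gsum, hb]
  rw [hg, hsum_eq hu, mul_comm] at h
  have := mul_left_cancel₀ (vand_ne_zero u hu.inj) h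
  rw [this]
  simp

theorem main_rect' {F : Type} [Field F] {n : ℕ} {u : Fin n → F} (hu : Gen_s9 u) (c : ℕ) :
    spdet (fun i => stair n i + 1) u * gsum (c + 1) u =
      vand u * ((∏ i, u i ^ (c : ℤ)) * spdet (fun i => stair n i + ((c : ℤ) + 1)) u) := by
  rw [weyl_denom hu, main_rect n (c + 1) u hu, hsum_eq hu]
  push_cast
  simp

/-! ### Pieri rule -/

/-- Elementary symmetric function. -/
def esym {F : Type} [Field F] {n : ℕ} (p : ℕ) (u : Fin n → F) : F :=
  ∑ S ∈ Finset.powersetCard p (Finset.univ : Finset (Fin n)), ∏ i ∈ S, u i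

/-- Indicator of a set. -/
def indS {n : ℕ} (S : Finset (Fin n)) (i : Fin n) : ℕ := if i ∈ S then 1 else 0

theorem esym_perm {F : Type} [Field F] {n : ℕ} (p : ℕ) (u : Fin n → F)
    (σ : Equiv.Perm (Fin n)) : esym p (fun i => u (σ i)) = esym p u := by
  unfold esym
  have h : (Finset.univ : Finset (Fin n)) = Finset.univ.map σ.toEmbedding := by simp
  conv_rhs => rw [h, Finset.powersetCard_map, Finset.sum_map]
  refine Finset.sum_congr rfl fun S _ => ?_
  simp [Finset.mapEmbedding, Finset.prod_map]

theorem altn_leibniz {F : Type} [Field F] {n : ℕ} (l : Fin n → ℤ) (u : Fin n → F) :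
    altn l u = ∑ σ : Equiv.Perm (Fin n), ((Equiv.Perm.sign σ : ℤ) : F) * ∏ i, u (σ i) ^ l i := by
  unfold altn
  rw [← Matrix.det_transpose, Matrix.det_apply']
  rfl

theorem pieri {F : Type} [Field F] {n : ℕ} (p : ℕ) (l : Fin n → ℤ) (u : Fin n → F)
    (hu : ∀ i, u i ≠ 0) :
    esym p u * altn l u = ∑ S ∈ Finset.powersetCard p (Finset.univ : Finset (Fin n)),
      altn (fun i => l i + (indS S i : ℤ)) u := by
  simp only [altn_leibniz, Finset.mul_sum]
  rw [Finset.sum_comm]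
  refine Finset.sum_congr rfl fun σ _ => ?_
  rw [← Finset.mul_sum, mul_left_comm, ← esym_perm p u σ, esym, Finset.sum_mul]
  congr 1
  refine Finset.sum_congr rfl fun S _ => ?_
  have : ∏ i ∈ S, u (σ i) = ∏ i, u (σ i) ^ (indS S i : ℤ) := by
    rw [← Finset.prod_subset (Finset.subset_univ S) (f := fun i => u (σ i) ^ (indS S i : ℤ))]
    · refine Finset.prod_congr rfl fun i hi => ?_
      simp [indS, hi]
    · intro i _ hi
      simp [indS, hi]
  rw [this, ← Finset.prod_mul_distrib]
  refine Finset.prod_congr rfl fun i _ => ?_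
  rw [zpow_add₀ (hu _), mul_comm]

theorem altn_eq_zero {F : Type} [Field F] {n : ℕ} (l : Fin n → ℤ) (u : Fin n → F) {i j : Fin n}
    (hij : i ≠ j) (h : l i = l j) : altn l u = 0 := by
  unfold altn
  refine Matrix.det_zero_of_row_eq hij ?_
  funext k
  simp [h]

theorem altn_not_antitone {F : Type} [Field F] {n : ℕ} (u : Fin n → F) (m : Fin n → ℕ)
    (hm : Antitone m) (S : Finset (Fin n)) (h : ¬ Antitone (fun i => 2 * m i + indS S i)) :
    altn (fun i => stair n i + 2 * (m i : ℤ) + (indS S i : ℤ)) u = 0 := by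
  cases n with
  | zero => exact absurd (fun i => i.elim0) h
  | succ n =>
    rw [Fin.antitone_iff_succ_le] at h
    push Not at h
    obtain ⟨i, hi⟩ := h
    have h1 : m i.succ ≤ m i.castSucc := hm (Fin.castSucc_lt_succ).le
    have h2 : indS S i.succ ≤ 1 := by unfold indS; split_ifs <;> simp
    refine altn_eq_zero _ _ (i := i.castSucc) (j := i.succ) (Fin.castSucc_lt_succ).ne ?_
    simp only [stair, Fin.val_castSucc, Fin.val_succ]
    push_cast
    omega

theorem esym_vand {F : Type} [Field F] {n : ℕ} (p : ℕ) (hp : p ≤ n) (u : Fin n → F)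
    (hu : ∀ i, u i ≠ 0) :
    esym p u * vand u = altn (fun i => stair n i + (if (i : ℕ) < p then 1 else 0)) u := by
  rw [← altn_stair, pieri p _ u hu]
  have hc : (Finset.univ.filter (fun i : Fin n => (i : ℕ) < p)).card = p := by
    rw [Fin.card_filter_val_lt]
    simp [hp]
  rw [Finset.sum_eq_single (Finset.univ.filter (fun i : Fin n => (i : ℕ) < p))]
  · congr 1
    funext i
    simp [indS]
  · intro S hS hne
    have hS' := (Finset.mem_powersetCard.mp hS).2
    have h0 := altn_not_antitone u (fun _ => 0) antitone_const S (by
      intro hanti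
      apply hne
      have hl : IsLowerSet (S : Set (Fin n)) := by
        intro a b hba ha
        by_contra hb
        have := hanti hba
        have ha' : a ∈ S := ha
        have hb' : b ∉ S := hb
        simp [indS, ha', hb'] at this
      have hl2 : IsLowerSet ((Finset.univ.filter (fun i : Fin n => (i : ℕ) < p) :
          Finset (Fin n)) : Set (Fin n)) := by
        intro a b hba ha
        simp only [Finset.coe_filter, Finset.mem_univ, true_and, Set.mem_ofPred_eq] at ha ⊢
        have : (b : ℕ) ≤ a := hba
        omega
      rcases hl.total hl2 with h | h
      · exact Finset.eq_of_subset_of_card_le (by exact_mod_cast h) (by rw [hc, hS'])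
      · exact (Finset.eq_of_subset_of_card_le (by exact_mod_cast h) (by rw [hc, hS'])).symm)
    simpa using h0
  · intro h
    exact absurd (Finset.mem_powersetCard.mpr ⟨Finset.subset_univ _, hc⟩) h

/-- The index set of the theorem. -/
def nuSet (n c d p : ℕ) : Finset (Fin n → ℕ) :=
  ((Fintype.piFinset fun _ : Fin n => Finset.range (c + d + 2)).filter
            (fun ν => Antitone ν ∧ (∀ i, d - c ≤ ν i) ∧
              (Finset.univ.filter
                (fun i : Fin n => Odd ((ν i : ℤ) - ((d : ℤ) - (c : ℤ))))).card = p))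

theorem sum_nuSet {F : Type} [Field F] {n : ℕ} (c d p : ℕ) (hcd : c ≤ d) (u : Fin n → F)
    (hu : ∀ i, u i ≠ 0) :
    ∑ ν ∈ nuSet n c d p, altn (fun i => stair n i + (ν i : ℤ) + 1) u =
      (∏ j, u j ^ ((d : ℤ) - c + 1)) * (esym p u * gsum (c + 1) u) := by
  unfold gsum
  simp only [Finset.mul_sum, pieri p _ u hu, ← altn_add_const _ _ hu]
  rw [← Finset.sum_product']
  rw [← Finset.sum_filter_of_ne (p := fun x : (Fin n → ℕ) × Finset (Fin n) =>
    Antitone (fun i => 2 * x.1 i + indS x.2 i))]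
  · have hodd : ∀ (a k : ℕ), d - c ≤ a →
        (Odd ((a : ℤ) - ((d : ℤ) - (c : ℤ))) ↔ (a - (d - c)) % 2 = 1) := by
      intro a _ h
      rw [Int.odd_iff]
      omega
    refine Finset.sum_nbij'
      (fun ν => (fun i => (ν i - (d - c)) / 2,
        Finset.univ.filter (fun i : Fin n => Odd ((ν i : ℤ) - ((d : ℤ) - (c : ℤ))))))
      (fun x => fun i => (d - c) + (2 * x.1 i + indS x.2 i)) ?_ ?_ ?_ ?_ ?_
    · intro ν hν
      simp only [nuSet, Finset.mem_filter, Fintype.mem_piFinset, Finset.mem_range] at hν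
      obtain ⟨hb, ha, hl, hc⟩ := hν
      simp only [Finset.mem_filter, Finset.mem_product, mem_boxp, Finset.mem_powersetCard]
      refine ⟨⟨⟨fun i => ?_, fun i j hij => ?_⟩, Finset.subset_univ _, hc⟩, fun i j hij => ?_⟩
      · have := hb i
        omega
      · have := ha hij
        simp only
        omega
      · have h1 := ha hij
        have h2 := hl i
        have h3 := hl j
        simp only [indS, Finset.mem_filter, Finset.mem_univ, true_and, hodd _ 0 h2, hodd _ 0 h3]
        split_ifs <;> omega
    · rintro ⟨m, S⟩ hx
      simp only [Finset.mem_filter, Finset.mem_product, mem_boxp, Finset.mem_powersetCard] at hx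
      obtain ⟨⟨⟨hb, ha⟩, -, hS⟩, hanti⟩ := hx
      simp only [nuSet, Finset.mem_filter, Fintype.mem_piFinset, Finset.mem_range]
      refine ⟨fun i => ?_, fun i j hij => ?_, fun i => by omega, ?_⟩
      · have := hb i
        unfold indS
        split_ifs <;> omega
      · have := hanti hij
        simp only at this ⊢
        omega
      · rw [← hS]
        congr 1
        ext i
        simp only [Finset.mem_filter, Finset.mem_univ, true_and]
        rw [hodd _ 0 (by omega)]
        unfold indS
        split_ifs with h
        · simp only [h, iff_true]; omega
        · simp only [h, iff_false]; omega
    · intro ν hν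
      simp only [nuSet, Finset.mem_filter, Fintype.mem_piFinset, Finset.mem_range] at hν
      obtain ⟨hb, ha, hl, hc⟩ := hν
      funext i
      have h2 := hl i
      simp only [indS, Finset.mem_filter, Finset.mem_univ, true_and, hodd _ 0 h2]
      split_ifs <;> omega
    · rintro ⟨m, S⟩ hx
      refine Prod.ext ?_ ?_
      · funext i
        simp only [indS]
        split_ifs <;> omega
      · ext i
        simp only [Finset.mem_filter, Finset.mem_univ, true_and]
        rw [hodd _ 0 (by omega)]
        unfold indS
        split_ifs with h
        · simp only [h, iff_true]; omega
        · simp only [h, iff_false]; omega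
    · intro ν hν
      simp only [nuSet, Finset.mem_filter, Fintype.mem_piFinset, Finset.mem_range] at hν
      obtain ⟨hb, ha, hl, hc⟩ := hν
      congr 1
      funext i
      have h2 := hl i
      simp only [indS, Finset.mem_filter, Finset.mem_univ, true_and, hodd _ 0 h2]
      split_ifs <;> push_cast <;> omega
  · rintro ⟨m, S⟩ hx hne
    by_contra hcon
    apply hne
    simp only [Finset.mem_product, mem_boxp] at hx
    simp only at hcon ⊢
    rw [altn_add_const _ _ hu, altn_not_antitone u m hx.1.2 S hcon, mul_zero]

theorem Xv_gen_s9 (n : ℕ) : Gen_s9 (Xv n) := by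
  have hinj : Function.Injective (algebraMap (MvPolynomial (Fin n) ℚ) (FF n)) :=
    IsFractionRing.injective _ _
  refine ⟨fun i h => ?_, fun i j h => ?_, fun i j h => ?_⟩
  · exact MvPolynomial.X_ne_zero i (hinj (by rw [map_zero]; exact h))
  · exact MvPolynomial.X_injective (hinj h)
  · unfold Xv at h
    rw [← map_mul, ← map_one (algebraMap (MvPolynomial (Fin n) ℚ) (FF n))] at h
    have := congrArg (MvPolynomial.eval (fun _ => (0 : ℚ))) (hinj h)
    simp at this

theorem spWeyl_eq {F : Type} [Field F] (n : ℕ) (lam : Fin n → ℤ) (x : Fin n → F) :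
    spWeyl n lam x = spdet (fun i => stair n i + lam i + 1) x /
      spdet (fun i => stair n i + 1) x := by
  have h1 : (fun i => stair n i + lam i + 1) = fun i : Fin n => lam i + (n : ℤ) - ((i : ℕ) : ℤ) := by
    funext i; unfold stair; ring
  have h2 : (fun i => stair n i + 1) = fun i : Fin n => (n : ℤ) - ((i : ℕ) : ℤ) := by
    funext i; unfold stair; ring
  rw [h1, h2]
  rfl

theorem prod_altn {F : Type} [Field F] {n : ℕ} (c d p : ℕ) (hpn : p ≤ n) (hcd : c ≤ d)
    {u : Fin n → F} (hu : Gen_s9 u) :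
    spdet (fun i => stair n i + c + 1) u *
      altn (fun i => stair n i + (if (i : ℕ) < p then (d : ℤ) + 1 else (d : ℤ)) + 1) u =
    spdet (fun i => stair n i + 1) u *
      ∑ ν ∈ nuSet n c d p, altn (fun i => stair n i + (ν i : ℤ) + 1) u := by
  rw [sum_nuSet c d p hcd u hu.ne_zero]
  have h1 : (fun i : Fin n => stair n i + (if (i : ℕ) < p then (d : ℤ) + 1 else (d : ℤ)) + 1) =
      fun i : Fin n => (stair n i + (if (i : ℕ) < p then 1 else 0)) + ((d : ℤ) + 1) := by
    funext i
    split_ifs <;> ring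
  have h2 : (fun i : Fin n => stair n i + (c : ℤ) + 1) = fun i => stair n i + ((c : ℤ) + 1) := by
    funext i
    ring
  have h3 : ∏ j, u j ^ ((d : ℤ) + 1) = (∏ j, u j ^ ((d : ℤ) - c + 1)) * ∏ j, u j ^ (c : ℤ) := by
    rw [← Finset.prod_mul_distrib]
    refine Finset.prod_congr rfl fun j _ => ?_
    rw [← zpow_add₀ (hu.ne_zero j)]
    congr 1
    ring
  rw [h1, altn_add_const _ _ hu.ne_zero, ← esym_vand p hpn u hu.ne_zero, h2, h3]
  linear_combination (-((∏ j, u j ^ ((d : ℤ) - c + 1)) * esym p u)) * main_rect' hu c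

/-- `sp_{2n}((c^n)) · sp_{2n}(((d+1)^p, d^{n-p}))
= ∑_{(d-c)^n ⊆ ν ⊆ ((c+d+1)^n), oddrows(ν/((d-c)^n)) = p} sp_{2n}(ν)`. -/
theorem spWeyl_mul_spWeyl_nearly_rectangular_le
    (n c d p : ℕ) (hpn : p ≤ n) (hcd : c ≤ d) :
    spWeyl n (fun _ : Fin n => (c : ℤ)) (Xv n) *
        spWeyl n (fun i : Fin n => if (i : ℕ) < p then (d : ℤ) + 1 else (d : ℤ)) (Xv n)
      = ∑ ν ∈ ((Fintype.piFinset fun _ : Fin n => Finset.range (c + d + 2)).filter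
            (fun ν => Antitone ν ∧ (∀ i, d - c ≤ ν i) ∧
              (Finset.univ.filter
                (fun i : Fin n => Odd ((ν i : ℤ) - ((d : ℤ) - (c : ℤ))))).card = p)),
          spWeyl n (fun i => (ν i : ℤ)) (Xv n) := by
  have hx := Xv_gen_s9 n
  have hne : spdet (fun i => stair n i + 1) (Xv n) ≠ 0 := by
    rw [weyl_denom hx]
    exact hx.weylDen_ne
  simp only [spWeyl_eq]
  rw [← Finset.sum_div, div_mul_div_comm, div_eq_div_iff (mul_ne_zero hne hne) hne]
  have key : spdet (fun i => stair n i + (c : ℤ) + 1) (Xv n) *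
      spdet (fun i => stair n i + (if (i : ℕ) < p then (d : ℤ) + 1 else (d : ℤ)) + 1) (Xv n) =
      spdet (fun i => stair n i + 1) (Xv n) *
        ∑ ν ∈ nuSet n c d p, spdet (fun i => stair n i + (ν i : ℤ) + 1) (Xv n) := by
    simp only [spdet_eq_sum (fun i : Fin n => stair n i + (_ : ℤ) + 1) (Xv n)]
    rw [← spdet_eq_sum]
    rw [Finset.sum_comm, Finset.mul_sum, Finset.mul_sum]
    refine Finset.sum_congr rfl fun e _ => ?_
    have h := prod_altn c d p hpn hcd (hx.flipv e)
    rw [spdet_flipv, spdet_flipv] at h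
    rw [← Finset.mul_sum]
    linear_combination h
  unfold nuSet at key
  rw [key]
  ring

end
end
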